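/- Let u = √3/2, let A(31,3) be the arrangement of 31 lines in ℙ²(ℝ) as above, with S its set of 127 intersection points and I = ⋂_{P∈S} I(P). Let B₂₁ be the sub-arrangement consisting of the 21 lines obtained from the seven linear forms x−uz, x+uz, x−4uz, x+4uz, y, y−z, y+z together with their images under the rotations by 60° and 120° about (0:0:1). Let f₁ = z, f₂ = x²+y², f₃ = 11x⁶+15x⁴y²+45x²y⁴+9y⁶, and let Γ be the degree-12 homogeneous polynomial Γ = (2093688/17)f₁¹² − (9398511/34)f₁¹⁰f₂ + (2995218/17)f₁⁸f₂² − (64485153/1088)f₁⁶f₂³ + (18708003/4352)f₁⁴f₂⁴ + (1258659/4352)f₁²f₂⁵ − (493695/4352)f₂⁶ + (2121309/1088)f₁⁶f₃ − (402561/4352)f₁⁴f₂f₃ − (158697/4352)f₁²f₂²f₃ + (2619/128)f₂³f₃ − (3979/4352)f₃². Then the degree-33 polynomial f equal to the product of the 21 linear forms defining B₂₁ and of Γ satisfies f ∈ I^(3) = ⋂_{P∈S} I(P)³ and f ∉ I². -/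

import Mathlib

open MvPolynomial

noncomputable section

/-- The polynomial ring `ℝ[x,y,z]`, with `x = X 0`, `y = X 1`, `z = X 2`. -/
abbrev PolyR := MvPolynomial (Fin 3) ℝ

/-- `u = √3 / 2`. -/
def u : ℝ := Real.sqrt 3 / 2

/-- The rotation by 60° about `(0:0:1)`. -/
def rotA : Matrix (Fin 3) (Fin 3) ℝ := !![1/2, -u, 0; u, 1/2, 0; 0, 0, 1]

/-- Linear substitution of variables by a matrix `M`:  `(substMat M f)(v) = f(M v)`. -/
def substMat (M : Matrix (Fin 3) (Fin 3) ℝ) : PolyR →ₐ[ℝ] PolyR :=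
  MvPolynomial.aeval fun i => ∑ j, MvPolynomial.C (M i j) * MvPolynomial.X j

/-- The ten initial linear forms of the arrangement `A(31,3)`:
`x`, `x ∓ uz`, `x ∓ 2uz`, `x ∓ 4uz`, `y`, `y ∓ z`. -/
def baseForms313 : Fin 10 → PolyR :=
  ![X 0, X 0 - C u * X 2, X 0 + C u * X 2, X 0 - C (2*u) * X 2, X 0 + C (2*u) * X 2,
    X 0 - C (4*u) * X 2, X 0 + C (4*u) * X 2, X 1, X 1 - X 2, X 1 + X 2]

/-- The 31 linear forms defining the simplicial arrangement `A(31,3)`: the ten initial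
forms, their images under the rotations by 60° and 120° about `(0:0:1)` (the image of a
line `{ℓ = 0}` under a matrix `M` being `{ℓ ∘ M⁻¹ = 0}`), and the line at infinity `z = 0`. -/
def lines313 : Fin 31 → PolyR := fun i =>
  if h : (i : ℕ) < 10 then baseForms313 ⟨i, h⟩
  else if h2 : (i : ℕ) < 20 then substMat rotA⁻¹ (baseForms313 ⟨(i : ℕ) - 10, by omega⟩)
  else if h3 : (i : ℕ) < 30 then substMat (rotA ^ 2)⁻¹ (baseForms313 ⟨(i : ℕ) - 20, by omega⟩)
  else X 2

/-- The seven initial linear forms of the sub-arrangement `B₂₁`: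
`x ∓ uz`, `x ∓ 4uz`, `y`, `y ∓ z`. -/
def baseFormsB : Fin 7 → PolyR :=
  ![X 0 - C u * X 2, X 0 + C u * X 2, X 0 - C (4*u) * X 2, X 0 + C (4*u) * X 2,
    X 1, X 1 - X 2, X 1 + X 2]

/-- The 21 linear forms defining the sub-arrangement `B₂₁`: the seven initial forms and
their images under the rotations by 60° and 120° about `(0:0:1)`. -/
def linesB21 : Fin 21 → PolyR := fun i =>
  if h : (i : ℕ) < 7 then baseFormsB ⟨i, h⟩
  else if h2 : (i : ℕ) < 14 then substMat rotA⁻¹ (baseFormsB ⟨(i : ℕ) - 7, by omega⟩)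
  else substMat (rotA ^ 2)⁻¹ (baseFormsB ⟨(i : ℕ) - 14, by omega⟩)

/-- The real projective plane `ℙ²(ℝ)`. -/
abbrev P2R := Projectivization ℝ (Fin 3 → ℝ)

open Classical in
/-- The number of lines of `A(31,3)` passing through a point `P ∈ ℙ²(ℝ)`. -/
def mult313 (P : P2R) : ℕ :=
  (Finset.univ.filter fun i => MvPolynomial.eval (Projectivization.rep P) (lines313 i) = 0).card

/-- The set of intersection points of `A(31,3)`: points lying on at least two lines. -/
def S313 : Set P2R := {P | 2 ≤ mult313 P}

/-- The homogeneous vanishing ideal `I(P)` of the projective point spanned by `v`: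
polynomials vanishing on the whole line `ℝ·v`. -/
def pointIdeal (v : Fin 3 → ℝ) : Ideal PolyR where
  carrier := {f | ∀ c : ℝ, MvPolynomial.eval (c • v) f = 0}
  zero_mem' := by intro c; simp
  add_mem' := by intro a b ha hb c; simp [ha c, hb c]
  smul_mem' := by intro a f hf c; simp [smul_eq_mul, hf c]

/-- The invariant `f₁ = z`. -/
def f1 : PolyR := X 2

/-- The invariant `f₂ = x² + y²`. -/
def f2 : PolyR := X 0 ^ 2 + X 1 ^ 2

/-- The invariant `f₃ = 11x⁶ + 15x⁴y² + 45x²y⁴ + 9y⁶`. -/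
def f3 : PolyR :=
  C 11 * X 0 ^ 6 + C 15 * X 0 ^ 4 * X 1 ^ 2 + C 45 * X 0 ^ 2 * X 1 ^ 4 + C 9 * X 1 ^ 6

/-- The degree-12 curve `Γ`, expressed in terms of the invariants `f₁`, `f₂`, `f₃`. -/
def Γpoly : PolyR :=
  C (2093688/17) * f1 ^ 12 - C (9398511/34) * f1 ^ 10 * f2 + C (2995218/17) * f1 ^ 8 * f2 ^ 2
    - C (64485153/1088) * f1 ^ 6 * f2 ^ 3 + C (18708003/4352) * f1 ^ 4 * f2 ^ 4
    + C (1258659/4352) * f1 ^ 2 * f2 ^ 5 - C (493695/4352) * f2 ^ 6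
    + C (2121309/1088) * f1 ^ 6 * f3 - C (402561/4352) * f1 ^ 4 * f2 * f3
    - C (158697/4352) * f1 ^ 2 * f2 ^ 2 * f3 + C (2619/128) * f2 ^ 3 * f3
    - C (3979/4352) * f3 ^ 2

end


/-! ### Part 0: the lines in rational coordinates -/

lemma u_sq : u ^ 2 = 3 / 4 := by
  unfold u; rw [div_pow, Real.sq_sqrt (by norm_num)]; norm_num

lemma u_ne : u ≠ 0 := by
  intro h; have := u_sq; rw [h] at this; norm_num at this

lemma eval_substMat (M : Matrix (Fin 3) (Fin 3) ℝ) (g : PolyR) (v : Fin 3 → ℝ) :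
    eval v (substMat M g) = eval (M.mulVec v) g := by
  unfold substMat
  have : (eval v).comp ((aeval fun i => ∑ j, C (M i j) * X j : PolyR →ₐ[ℝ] PolyR) : PolyR →+* PolyR)
      = eval (M.mulVec v) := by
    apply MvPolynomial.ringHom_ext
    · intro r; simp
    · intro i; simp [Matrix.mulVec, dotProduct]
  exact congrArg (fun h => h g) this

lemma rotA_inv : rotA⁻¹ = !![1/2, u, 0; -u, 1/2, 0; 0, 0, 1] := by
  apply Matrix.inv_eq_right_inv
  have h := u_sq
  ext i j
  fin_cases i <;> fin_cases j <;> simp [rotA, Matrix.mul_apply, Fin.sum_univ_three] <;> nlinarith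

lemma rotA2_inv : (rotA ^ 2)⁻¹ = !![-1/2, u, 0; -u, -1/2, 0; 0, 0, 1] := by
  rw [← Matrix.inv_pow', rotA_inv]
  have h := u_sq
  ext i j
  fin_cases i <;> fin_cases j <;>
    simp [pow_two, Matrix.mul_apply, Fin.sum_univ_three] <;> nlinarith

def LzL : List (ℤ × ℤ × ℤ) :=
  [(1,0,0),(1,0,-1),(1,0,1),(1,0,-2),(1,0,2),(1,0,-4),(1,0,4),(0,1,0),(0,1,-1),(0,1,1),
   (1,2,0),(1,2,-2),(1,2,2),(1,2,-4),(1,2,4),(1,2,-8),(1,2,8),(-3,2,0),(-3,2,-4),(-3,2,4),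
   (-1,2,0),(-1,2,-2),(-1,2,2),(-1,2,-4),(-1,2,4),(-1,2,-8),(-1,2,8),(-3,-2,0),(-3,-2,-4),
   (-3,-2,4),(0,0,1)]

def Lz (i : Fin 31) : ℤ × ℤ × ℤ := LzL.getD i.1 (0,0,0)

def dotz (a b : ℤ × ℤ × ℤ) : ℤ := a.1 * b.1 + a.2.1 * b.2.1 + a.2.2 * b.2.2

lemma eval_base (i : Fin 10) (v : Fin 3 → ℝ) : eval v (baseForms313 i) =
    ![v 0, v 0 - u * v 2, v 0 + u * v 2, v 0 - 2 * u * v 2, v 0 + 2 * u * v 2,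
      v 0 - 4 * u * v 2, v 0 + 4 * u * v 2, v 1, v 1 - v 2, v 1 + v 2] i := by
  fin_cases i <;> simp [baseForms313]

lemma line_eval (i : Fin 31) : ∃ s : ℝ, s ≠ 0 ∧ ∀ a b c : ℝ, eval ![u * a, b, c] (lines313 i) =
    s * (((Lz i).1 : ℝ) * a + ((Lz i).2.1 : ℝ) * b + ((Lz i).2.2 : ℝ) * c) := by
  have hu := u_sq
  have hu0 := u_ne
  have hu2 : u / 2 ≠ 0 := by simpa using hu0
  by_cases h1 : (i : ℕ) < 10
  · obtain ⟨i, hi⟩ := i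
    simp only [lines313, h1, dite_true, eval_base]
    interval_cases i <;>
    first
    | (refine ⟨u, hu0, fun a b c => ?_⟩; simp [Lz, LzL]; ring1)
    | (refine ⟨1, one_ne_zero, fun a b c => ?_⟩; simp [Lz, LzL]; ring1)
    | (refine ⟨1, one_ne_zero, fun a b c => ?_⟩; simp [Lz, LzL]; done)
    | (refine ⟨u, hu0, fun a b c => ?_⟩; simp [Lz, LzL]; done)
  by_cases h2 : (i : ℕ) < 20
  · obtain ⟨i, hi⟩ := i
    simp only [lines313, h1, h2, dite_true, dite_false, eval_substMat, eval_base, rotA_inv]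
    push Not at h1
    simp only at h1 h2
    interval_cases i <;>
    first
    | (refine ⟨u/2, hu2, fun a b c => ?_⟩
       simp [Lz, LzL, Matrix.mulVec, dotProduct, Fin.sum_univ_three]; ring; done)
    | (refine ⟨1/4, by norm_num, fun a b c => ?_⟩
       simp [Lz, LzL, Matrix.mulVec, dotProduct, Fin.sum_univ_three]; linear_combination (-a) * hu)
  by_cases h3 : (i : ℕ) < 30
  · obtain ⟨i, hi⟩ := i
    simp only [lines313, h1, h2, h3, dite_true, dite_false, eval_substMat, eval_base, rotA2_inv]
    push Not at h2
    simp only at h2 h3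
    interval_cases i <;>
    first
    | (refine ⟨u/2, hu2, fun a b c => ?_⟩
       simp [Lz, LzL, Matrix.mulVec, dotProduct, Fin.sum_univ_three]; ring; done)
    | (refine ⟨1/4, by norm_num, fun a b c => ?_⟩
       simp [Lz, LzL, Matrix.mulVec, dotProduct, Fin.sum_univ_three]; linear_combination (-a) * hu)
  · obtain ⟨i, hi⟩ := i
    have : i = 30 := by simp only at h3; omega
    subst this
    exact ⟨1, one_ne_zero, fun a b c => by simp [lines313, Lz, LzL]⟩

def idxB (i : Fin 21) : Fin 31 :=
  ⟨([1,2,5,6,7,8,9,11,12,15,16,17,18,19,21,22,25,26,27,28,29].getD i.1 0) % 31,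
    Nat.mod_lt _ (by norm_num)⟩

lemma linesB_eq (i : Fin 21) : linesB21 i = lines313 (idxB i) := by
  obtain ⟨i, hi⟩ := i
  interval_cases i <;> simp [linesB21, lines313, idxB, baseFormsB, baseForms313]

lemma line_eval_zero (i : Fin 31) (w : ℤ × ℤ × ℤ) (t : ℝ) (ht : t ≠ 0) :
    eval ![u * (t * w.1), t * w.2.1, t * w.2.2] (lines313 i) = 0 ↔ dotz (Lz i) w = 0 := by
  obtain ⟨s, hs, h⟩ := line_eval i
  rw [h]
  have : s * (((Lz i).1 : ℝ) * (t * w.1) + ((Lz i).2.1 : ℝ) * (t * w.2.1) + ((Lz i).2.2 : ℝ) * (t * w.2.2))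
     = s * t * ((dotz (Lz i) w : ℤ) : ℝ) := by
    simp only [dotz]; push_cast; ring
  rw [this]
  simp [hs, ht]

lemma line_homog (i : Fin 31) (c : ℝ) (v : Fin 3 → ℝ) :
    eval (c • v) (lines313 i) = c * eval v (lines313 i) := by
  obtain ⟨s, hs, h⟩ := line_eval i
  have e1 : v = ![u * (v 0 / u), v 1, v 2] := by
    ext k; fin_cases k <;> simp [mul_div_cancel₀ _ u_ne]
  have e2 : c • v = ![u * (c * (v 0 / u)), c * v 1, c * v 2] := by
    ext k; fin_cases k <;> simp
    field_simp [u_ne]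
  rw [e2, h]
  conv_rhs => rw [e1, h]
  ring



/-! ### Part 1: membership in the symbolic cube -/

section GammaZ
variable {R : Type*} [CommRing R]

def bZ (x y : R) : R := 3 * x ^ 2 + 4 * y ^ 2
def cZ (x y : R) : R := 33 * x ^ 6 + 60 * x ^ 4 * y ^ 2 + 240 * x ^ 2 * y ^ 4 + 64 * y ^ 6

def gamN (z b c : R) : R :=
    2195390988288 * z ^ 12 + (-1231881633792) * z ^ 10 * b ^ 1 + 196294606848 * z ^ 8 * b ^ 2 +
    (-16508199168) * z ^ 6 * b ^ 3 + 299328048 * z ^ 4 * b ^ 4 + 5034636 * z ^ 2 * b ^ 5 +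
    (-493695) * b ^ 6 + 4887495936 * z ^ 6 * c ^ 1 + (-57968784) * z ^ 4 * b ^ 1 * c ^ 1 +
    (-5713092) * z ^ 2 * b ^ 2 * c ^ 1 + 801414 * b ^ 3 * c ^ 1 + (-322299) * c ^ 2

def gam1 (z b c : R) : R :=
    26344691859456 * z ^ 11 + (-12318816337920) * z ^ 9 * b ^ 1 + 1570356854784 * z ^ 7 * b ^ 2 +
    (-99049195008) * z ^ 5 * b ^ 3 + 1197312192 * z ^ 3 * b ^ 4 + 10069272 * z ^ 1 * b ^ 5 +
    29324975616 * z ^ 5 * c ^ 1 + (-231875136) * z ^ 3 * b ^ 1 * c ^ 1 + (-11426184) * z ^ 1 * b ^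
    2 * c ^ 1

def gam2 (z b c : R) : R :=
    (-1231881633792) * z ^ 10 + 392589213696 * z ^ 8 * b ^ 1 + (-49524597504) * z ^ 6 * b ^ 2 +
    1197312192 * z ^ 4 * b ^ 3 + 25173180 * z ^ 2 * b ^ 4 + (-2962170) * b ^ 5 + (-57968784) * z ^
    4 * c ^ 1 + (-11426184) * z ^ 2 * b ^ 1 * c ^ 1 + 2404242 * b ^ 2 * c ^ 1

def gam3 (z b c : R) : R :=
    4887495936 * z ^ 6 + (-57968784) * z ^ 4 * b ^ 1 + (-5713092) * z ^ 2 * b ^ 2 + 801414 * b ^ 3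
    + (-644598) * c ^ 1

end GammaZ

lemma eval_f (t x y z : ℝ) : eval ![u * (t * x), t * y, t * z] f1 = t * z ∧
    eval ![u * (t * x), t * y, t * z] f2 = t ^ 2 * bZ x y / 4 ∧
    eval ![u * (t * x), t * y, t * z] f3 = t ^ 6 * (9 * cZ x y) / 64 := by
  have h := u_sq
  have h4 : u ^ 4 = 9 / 16 := by rw [show u ^ 4 = (u ^ 2) ^ 2 by ring, h]; norm_num
  have h6 : u ^ 6 = 27 / 64 := by rw [show u ^ 6 = (u ^ 2) ^ 3 by ring, h]; norm_num
  refine ⟨by simp [f1], ?_, ?_⟩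
  · simp only [f2, bZ, map_add, map_pow, eval_X]
    simp [mul_pow, h]; ring
  · simp only [f3, cZ, map_add, map_mul, eval_C, map_pow, eval_X]
    simp [mul_pow, h4, h6, h]; ring

lemma eval_gam (t x y z : ℝ) : eval ![u * (t * x), t * y, t * z] Γpoly =
    t ^ 12 / 17825792 * gamN z (bZ x y) (cZ x y) := by
  obtain ⟨e1, e2, e3⟩ := eval_f t x y z
  simp only [Γpoly, map_add, map_sub, map_mul, map_pow, eval_C, e1, e2, e3, gamN]
  ring

lemma eval_deriv_gam (D : Derivation ℝ PolyR PolyR) (t x y z : ℝ) :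
    eval ![u * (t * x), t * y, t * z] (D Γpoly) = 1 / 17825792 *
      (t ^ 11 * gam1 z (bZ x y) (cZ x y) * eval ![u * (t * x), t * y, t * z] (D f1)
      + t ^ 10 * 4 * gam2 z (bZ x y) (cZ x y) * eval ![u * (t * x), t * y, t * z] (D f2)
      + t ^ 6 * (64 / 9) * gam3 z (bZ x y) (cZ x y) * eval ![u * (t * x), t * y, t * z] (D f3)) := by
  have hC : ∀ r : ℝ, D (C r) = 0 := fun r => by
    have := D.map_algebraMap r
    rwa [MvPolynomial.algebraMap_eq] at this
  obtain ⟨e1, e2, e3⟩ := eval_f t x y z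
  simp only [Γpoly, map_add, map_sub, Derivation.leibniz, Derivation.leibniz_pow, hC, smul_eq_mul,
    smul_zero, map_mul, map_pow, eval_C, e1, e2, e3, nsmul_eq_mul, map_natCast, map_zero,
    gam1, gam2, gam3]
  push_cast
  ring

lemma eval_pd (t x y z : ℝ) (hx : 6 * x * gam2 z (bZ x y) (cZ x y)
      + (198 * x ^ 5 + 240 * x ^ 3 * y ^ 2 + 480 * x * y ^ 4) * gam3 z (bZ x y) (cZ x y) = 0)
    (hy : 8 * y * gam2 z (bZ x y) (cZ x y)
      + (120 * x ^ 4 * y + 960 * x ^ 2 * y ^ 3 + 384 * y ^ 5) * gam3 z (bZ x y) (cZ x y) = 0)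
    (hz : gam1 z (bZ x y) (cZ x y) = 0) (k : Fin 3) :
    eval ![u * (t * x), t * y, t * z] (pderiv k Γpoly) = 0 := by
  rw [eval_deriv_gam, hz]
  generalize gam2 z (bZ x y) (cZ x y) = A at *
  generalize gam3 z (bZ x y) (cZ x y) = B at *
  have h := u_sq
  have h4 : u ^ 4 = 9 / 16 := by rw [show u ^ 4 = (u ^ 2) ^ 2 by ring, h]; norm_num
  have h3 : u ^ 3 = 3 / 4 * u := by rw [show u ^ 3 = (u ^ 2) * u by ring, h]
  have h5 : u ^ 5 = 9 / 16 * u := by rw [show u ^ 5 = (u ^ 4) * u by ring, h4]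
  fin_cases k
  · simp [f1, f2, f3, Derivation.leibniz_pow, pderiv_X, mul_pow, h3, h5, h4, h]
    linear_combination (u * t ^ 11 * 4 / 3) * hx
  · simp [f1, f2, f3, Derivation.leibniz_pow, pderiv_X, mul_pow, h3, h5, h4, h]
    linear_combination (t ^ 11) * hy
  · simp [f1, f2, f3, Derivation.leibniz_pow, pderiv_X, mul_pow, h3, h5, h4, h]


lemma mem_sq_of_taylor (v : Fin 3 → ℝ) (k : Fin 3) (hk : v k ≠ 0) (F : PolyR)
    (h0 : ∀ c : ℝ, eval (c • v) F = 0) (h1 : ∀ j, ∀ c : ℝ, eval (c • v) (pderiv j F) = 0) :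
    F ∈ pointIdeal v ^ 2 := by
  let σ : PolyR →ₐ[ℝ] PolyR := aeval fun j => C (v j / v k) * X k
  have hσe : ∀ (G : PolyR) (p : Fin 3 → ℝ), eval p (σ G) = eval ((p k / v k) • v) G := by
    intro G p
    have : (eval p).comp (σ : PolyR →+* PolyR) = eval ((p k / v k) • v) := by
      apply MvPolynomial.ringHom_ext
      · intro r; simp [σ]
      · intro i; simp [σ]; ring
    exact congrArg (fun h => h G) this
  have hσ0 : ∀ G : PolyR, (∀ c : ℝ, eval (c • v) G = 0) → σ G = 0 := by
    intro G hG
    apply MvPolynomial.funext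
    intro p
    rw [hσe, hG, map_zero]
  have hd : ∀ j, (X j - σ (X j) : PolyR) ∈ pointIdeal v := by
    intro j c
    rw [map_sub, hσe]
    simp
    field_simp
    ring
  have hG : ∀ G : PolyR, G - σ G ∈ pointIdeal v := by
    intro G c
    rw [map_sub, hσe]
    have : ((c • v) k / v k) = c := by simp [hk]
    rw [this, sub_self]
  have key : ∀ G : PolyR, G - (σ G + ∑ j, σ (pderiv j G) * (X j - σ (X j))) ∈ pointIdeal v ^ 2 := by
    intro G
    induction G using MvPolynomial.induction_on with
    | C a => simp [σ]
    | add p q hp hq =>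
      have := Ideal.add_mem _ hp hq
      convert this using 1
      simp only [map_add, add_mul, Finset.sum_add_distrib]
      ring
    | mul_X p n hp =>
      have e : p * X n - (σ (p * X n) + ∑ j, σ (pderiv j (p * X n)) * (X j - σ (X j)))
          = (p - (σ p + ∑ j, σ (pderiv j p) * (X j - σ (X j)))) * X n
            + ((∑ j, σ (pderiv j p) * (X j - σ (X j))) * (X n - σ (X n))) := by
        have e2 : ∑ j, σ (pderiv j (p * X n)) * (X j - σ (X j))
            = (∑ j, σ (pderiv j p) * (X j - σ (X j))) * σ (X n) + σ p * (X n - σ (X n)) := by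
          have : ∀ j, σ (pderiv j (p * X n)) * (X j - σ (X j)) =
              σ (pderiv j p) * (X j - σ (X j)) * σ (X n) +
                (if j = n then σ p * (X n - σ (X n)) else 0) := by
            intro j
            rw [Derivation.leibniz]
            split_ifs with hjn
            · subst hjn; simp only [pderiv_X_self, smul_eq_mul, map_add, map_mul, map_one]; ring
            · rw [pderiv_X_of_ne (Ne.symm hjn)]; simp only [smul_eq_mul, map_add, map_mul, map_zero]; ring
          simp only [this, Finset.sum_add_distrib, ← Finset.sum_mul]
          simp
        rw [e2, map_mul]; ring
      rw [e]
      refine Ideal.add_mem _ (Ideal.mul_mem_right _ _ hp) ?_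
      rw [pow_two]
      exact Ideal.mul_mem_mul (Ideal.sum_mem _ fun j _ => Ideal.mul_mem_left _ _ (hd j)) (hd n)
  have := key F
  rw [hσ0 F h0] at this
  simpa [hσ0 _ (h1 _)] using this

def crz (a b : ℤ × ℤ × ℤ) : ℤ × ℤ × ℤ :=
  (a.2.1 * b.2.2 - a.2.2 * b.2.1, a.2.2 * b.1 - a.1 * b.2.2, a.1 * b.2.1 - a.2.1 * b.1)

def cntB (W : ℤ × ℤ × ℤ) : ℕ :=
  (Finset.univ.filter fun k : Fin 21 => dotz (Lz (idxB k)) W = 0).card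

def gam0Z (W : ℤ × ℤ × ℤ) : Prop := gamN W.2.2 (bZ W.1 W.2.1) (cZ W.1 W.2.1) = 0
def gamDZ (W : ℤ × ℤ × ℤ) : Prop :=
  6 * W.1 * gam2 W.2.2 (bZ W.1 W.2.1) (cZ W.1 W.2.1)
      + (198 * W.1 ^ 5 + 240 * W.1 ^ 3 * W.2.1 ^ 2 + 480 * W.1 * W.2.1 ^ 4) *
        gam3 W.2.2 (bZ W.1 W.2.1) (cZ W.1 W.2.1) = 0 ∧
  8 * W.2.1 * gam2 W.2.2 (bZ W.1 W.2.1) (cZ W.1 W.2.1)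
      + (120 * W.1 ^ 4 * W.2.1 + 960 * W.1 ^ 2 * W.2.1 ^ 3 + 384 * W.2.1 ^ 5) *
        gam3 W.2.2 (bZ W.1 W.2.1) (cZ W.1 W.2.1) = 0 ∧
  gam1 W.2.2 (bZ W.1 W.2.1) (cZ W.1 W.2.1) = 0

instance (W) : Decidable (gam0Z W) := inferInstanceAs (Decidable (_ = _))
instance (W) : Decidable (gamDZ W) := inferInstanceAs (Decidable (_ ∧ _ ∧ _))

lemma pairs_check : ∀ i j : Fin 31, i < j → crz (Lz i) (Lz j) ≠ (0, 0, 0) ∧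
    (3 ≤ cntB (crz (Lz i) (Lz j)) ∨
      (2 ≤ cntB (crz (Lz i) (Lz j)) ∧ gam0Z (crz (Lz i) (Lz j))) ∨
      (1 ≤ cntB (crz (Lz i) (Lz j)) ∧ gam0Z (crz (Lz i) (Lz j)) ∧ gamDZ (crz (Lz i) (Lz j)))) := by
  decide +kernel

lemma mem_cube (v : Fin 3 → ℝ) (W : ℤ × ℤ × ℤ) (t : ℝ) (ht : t ≠ 0) (hW : W ≠ (0, 0, 0))
    (hv : v = ![u * (t * W.1), t * W.2.1, t * W.2.2])
    (hc : 3 ≤ cntB W ∨ (2 ≤ cntB W ∧ gam0Z W) ∨ (1 ≤ cntB W ∧ gam0Z W ∧ gamDZ W)) :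
    (∏ i : Fin 21, linesB21 i) * Γpoly ∈ pointIdeal v ^ 3 := by
  classical
  have hcv : ∀ c : ℝ, c • v = ![u * ((c * t) * W.1), (c * t) * W.2.1, (c * t) * W.2.2] := by
    intro c; rw [hv]; ext k; fin_cases k <;> simp <;> ring
  have hvne : ∃ k, v k ≠ 0 := by
    by_contra hcon
    push Not at hcon
    have a0 := hcon 0
    have a1 := hcon 1
    have a2 := hcon 2
    simp [hv, ht, u_ne] at a0 a1 a2
    exact hW (by ext <;> simp [a0, a1, a2])
  have hprod : ∏ i : Fin 21, linesB21 i ∈ pointIdeal v ^ (cntB W) := by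
    rw [cntB, ← Finset.prod_filter_mul_prod_filter_not Finset.univ
      (fun k : Fin 21 => dotz (Lz (idxB k)) W = 0)]
    apply Ideal.mul_mem_right
    rw [← Finset.prod_const]
    apply Ideal.prod_mem_prod
    intro i hi c
    simp only [Finset.mem_filter] at hi
    rw [linesB_eq, line_homog, hv, (line_eval_zero _ W t ht).2 hi.2, mul_zero]
  have h0 : gam0Z W → ∀ c : ℝ, eval (c • v) Γpoly = 0 := by
    intro h c
    have h' : gamN (W.2.2 : ℝ) (bZ W.1 W.2.1) (cZ W.1 W.2.1) = 0 := by
      have := congrArg (fun z : ℤ => (z : ℝ)) h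
      simp only [gamN, bZ, cZ] at this ⊢
      push_cast at this
      exact this
    rw [hcv, eval_gam, h', mul_zero]
  have fin : ∀ n, 3 ≤ cntB W + n → Γpoly ∈ pointIdeal v ^ n →
      (∏ i : Fin 21, linesB21 i) * Γpoly ∈ pointIdeal v ^ 3 := by
    intro n hn hg
    apply Ideal.pow_le_pow_right hn
    rw [pow_add]
    exact Ideal.mul_mem_mul hprod hg
  rcases hc with hc | ⟨hc, hg⟩ | ⟨hc, hg, hd⟩
  · exact fin 0 (by omega) (by simp)
  · exact fin 1 (by omega) (by rw [pow_one]; exact h0 hg)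
  · refine fin 2 (by omega) ?_
    obtain ⟨k, hk⟩ := hvne
    refine mem_sq_of_taylor v k hk _ (h0 hg) ?_
    intro j c
    obtain ⟨d1, d2, d3⟩ := hd
    have d1' := congrArg (fun z : ℤ => (z : ℝ)) d1
    have d2' := congrArg (fun z : ℤ => (z : ℝ)) d2
    have d3' := congrArg (fun z : ℤ => (z : ℝ)) d3
    rw [hcv]
    apply eval_pd
    · simp only [gam2, gam3, bZ, cZ] at d1' ⊢
      push_cast at d1'
      exact d1'
    · simp only [gam2, gam3, bZ, cZ] at d2' ⊢
      push_cast at d2'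
      exact d2'
    · simp only [gam1, bZ, cZ] at d3' ⊢
      push_cast at d3'
      exact d3'

lemma part1 : (∏ i : Fin 21, linesB21 i) * Γpoly ∈
        (⨅ P ∈ S313, (pointIdeal (Projectivization.rep P)) ^ 3) := by
  classical
  simp only [Submodule.mem_iInf]
  intro P hP
  have hv := Projectivization.rep_nonzero P
  have hP' : 1 < (Finset.univ.filter fun i => MvPolynomial.eval (Projectivization.rep P) (lines313 i) = 0).card := by
    have : 2 ≤ mult313 P := hP
    unfold mult313 at this
    exact lt_of_lt_of_le one_lt_two (by convert this)
  generalize Projectivization.rep P = v at *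
  obtain ⟨i, hi, j, hj, hij⟩ := Finset.one_lt_card.1 hP'
  wlog hlt : i < j generalizing i j
  · exact this j hj i hi hij.symm (lt_of_le_of_ne (not_lt.1 hlt) hij.symm)
  obtain ⟨hW, hc⟩ := pairs_check i j hlt
  simp only [Finset.mem_filter, Finset.mem_univ, true_and] at hi hj
  have e1 : v = ![u * (v 0 / u), v 1, v 2] := by
    ext k; fin_cases k <;> simp [mul_div_cancel₀ _ u_ne]
  obtain ⟨s, hs, h⟩ := line_eval i
  obtain ⟨s', hs', h'⟩ := line_eval j
  rw [e1, h] at hi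
  rw [e1, h'] at hj
  have hi := (mul_eq_zero.1 hi).resolve_left hs
  have hj := (mul_eq_zero.1 hj).resolve_left hs'
  have hne : ¬ (v 0 / u = 0 ∧ v 1 = 0 ∧ v 2 = 0) := by
    rintro ⟨a0, a1, a2⟩
    apply hv
    rw [e1, a0, a1, a2]
    ext k; fin_cases k <;> simp
  have : ∃ t : ℝ, v 0 / u = t * (crz (Lz i) (Lz j)).1 ∧ v 1 = t * (crz (Lz i) (Lz j)).2.1 ∧
      v 2 = t * (crz (Lz i) (Lz j)).2.2 := by
    generalize Lz i = l at *
    generalize Lz j = m at *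
    generalize v 0 / u = a at *
    generalize v 1 = b at *
    generalize v 2 = c at *
    have q0 : b * ((crz l m).2.2 : ℝ) = c * (crz l m).2.1 := by
      simp only [crz]; push_cast
      linear_combination -(m.1 : ℝ) * hi + (l.1 : ℝ) * hj
    have q1 : c * ((crz l m).1 : ℝ) = a * (crz l m).2.2 := by
      simp only [crz]; push_cast
      linear_combination -(m.2.1 : ℝ) * hi + (l.2.1 : ℝ) * hj
    have q2 : a * ((crz l m).2.1 : ℝ) = b * (crz l m).1 := by
      simp only [crz]; push_cast
      linear_combination -(m.2.2 : ℝ) * hi + (l.2.2 : ℝ) * hj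
    by_cases w0 : (crz l m).1 = 0
    · by_cases w1 : (crz l m).2.1 = 0
      · have w2 : (crz l m).2.2 ≠ 0 := by
          intro w2; exact hW (by ext <;> simp [w0, w1, w2])
        have w2' : ((crz l m).2.2 : ℝ) ≠ 0 := by exact_mod_cast w2
        refine ⟨c / (crz l m).2.2, ?_, ?_, ?_⟩ <;> field_simp <;> linarith
      · have w1' : ((crz l m).2.1 : ℝ) ≠ 0 := by exact_mod_cast w1
        refine ⟨b / (crz l m).2.1, ?_, ?_, ?_⟩ <;> field_simp <;> linarith
    · have w0' : ((crz l m).1 : ℝ) ≠ 0 := by exact_mod_cast w0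
      refine ⟨a / (crz l m).1, ?_, ?_, ?_⟩ <;> field_simp <;> linarith
  obtain ⟨t, t0, t1, t2⟩ := this
  have ht : t ≠ 0 := by
    rintro rfl
    exact hne ⟨by simpa using t0, by simpa using t1, by simpa using t2⟩
  refine mem_cube v _ t ht hW ?_ hc
  rw [← t0, ← t1, ← t2]
  exact e1


/-! ### Part 2a: nonsingularity of integer matrices by elimination modulo a prime -/

def forceN {α : Type} (n : ℕ) (k : ℕ → α) : α := Nat.rec (k 0) (fun m _ => k (m + 1)) n

lemma forceN_eq {α : Type} (n : ℕ) (k : ℕ → α) : forceN n k = k n := by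
  cases n <;> rfl

def combL (a b : ℕ) : List ℕ → List ℕ → (List ℕ → Bool) → Bool
  | x :: xs, y :: ys, k => forceN ((a * y + b * x) % 10007) fun z => combL a b xs ys fun r => k (z :: r)
  | _, _, k => k []

def combR (a : ℕ) (as : List ℕ) : List (List ℕ) → (List (List ℕ) → Bool) → Bool
  | [], k => k []
  | [] :: rs, k => combR a as rs fun r => k ([] :: r)
  | (b :: bs) :: rs, k => forceN (10007 - b % 10007) fun b' => combL a b' as bs fun row =>
      combR a as rs fun r => k (row :: r)

def elimB : ℕ → List (List ℕ) → Bool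
  | 0, _ => true
  | n + 1, (a :: as) :: rs => !(Nat.beq (a % 10007) 0) && combR a as rs (elimB n)
  | _, _ => false

def combL' (a b : ℕ) (xs ys : List ℕ) : List ℕ := List.zipWith (fun x y => (a * y + b * x) % 10007) xs ys

lemma combL_eq (a b : ℕ) (xs : List ℕ) : ∀ (ys : List ℕ) (k : List ℕ → Bool),
    combL a b xs ys k = k (combL' a b xs ys) := by
  induction xs with
  | nil => intro ys k; cases ys <;> rfl
  | cons x xs ih =>
    intro ys k
    cases ys with
    | nil => rfl
    | cons y ys => simp only [combL, forceN_eq, ih]; rfl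

def combR' (a : ℕ) (as : List ℕ) (rs : List (List ℕ)) : List (List ℕ) :=
  rs.map fun r => match r with
    | [] => []
    | b :: bs => combL' a (10007 - b % 10007) as bs

lemma combR_eq (a : ℕ) (as : List ℕ) (rs : List (List ℕ)) : ∀ k : List (List ℕ) → Bool,
    combR a as rs k = k (combR' a as rs) := by
  induction rs with
  | nil => intro k; rfl
  | cons r rs ih =>
    intro k
    cases r with
    | nil => simp only [combR, ih]; rfl
    | cons b bs => simp only [combR, forceN_eq, combL_eq, ih]; rfl

section
variable {K : Type*} [CommRing K]

def dotL : List K → List K → K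
  | x :: xs, y :: ys => x * y + dotL xs ys
  | _, _ => 0

lemma dotL_sum : ∀ (n : ℕ) (a b : List K), a.length = n → b.length = n →
    dotL a b = ∑ j : Fin n, a.getD j 0 * b.getD j 0 := by
  intro n
  induction n with
  | zero => intro a b ha hb; rw [List.length_eq_zero_iff] at ha; subst ha; simp [dotL]
  | succ n ih =>
    intro a b ha hb
    cases a with
    | nil => simp at ha
    | cons x xs =>
      cases b with
      | nil => simp at hb
      | cons y ys =>
        rw [dotL, ih xs ys (by simpa using ha) (by simpa using hb), Fin.sum_univ_succ]
        simp
end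

abbrev Kp := ZMod 10007

instance factP : Fact (Nat.Prime 10007) := ⟨by norm_num⟩

def cst (r : List ℕ) : List Kp := r.map (Nat.cast : ℕ → Kp)

lemma dot_comb (a b : ℕ) (xs : List ℕ) : ∀ (ys : List ℕ) (v : List Kp), xs.length = ys.length →
    dotL (cst (combL' a b xs ys)) v = (a : Kp) * dotL (cst ys) v + (b : Kp) * dotL (cst xs) v := by
  induction xs with
  | nil =>
    intro ys v h
    have : ys = [] := List.length_eq_zero_iff.1 h.symm
    subst this; simp [combL', cst, dotL]
  | cons x xs ih =>
    intro ys v h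
    cases ys with
    | nil => simp at h
    | cons y ys =>
      cases v with
      | nil => simp [combL', cst, dotL]
      | cons w ws =>
        have := ih ys ws (by simpa using h)
        simp only [cst, combL', List.zipWith_cons_cons, List.map_cons, dotL] at this ⊢
        rw [this, ZMod.natCast_mod]
        push_cast; ring

lemma elim_sound : ∀ (n : ℕ) (rows : List (List ℕ)) (v : List Kp), elimB n rows = true →
    v.length = n → (∀ r ∈ rows, r.length = n) → (∀ r ∈ rows, dotL (cst r) v = 0) → ∀ x ∈ v, x = 0 := by
  intro n
  induction n with
  | zero => intro rows v _ hv _ _ x hx; rw [List.length_eq_zero_iff] at hv; subst hv; simp at hx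
  | succ n ih =>
    intro rows v he hv hl hd
    cases rows with
    | nil => simp [elimB] at he
    | cons r rs =>
      cases r with
      | nil => simp [elimB] at he
      | cons a as =>
        simp only [elimB, combR_eq, Bool.and_eq_true] at he
        obtain ⟨ha, he⟩ := he
        have ha' : (a : Kp) ≠ 0 := by
          intro h
          rw [ZMod.natCast_eq_zero_iff] at h
          simp [Nat.mod_eq_zero_of_dvd h] at ha
        have hlas : as.length = n := by simpa using hl (a :: as) (by simp)
        cases v with
        | nil => simp at hv
        | cons w ws =>
          have h0 : (a : Kp) * w + dotL (cst as) ws = 0 := hd (a :: as) (by simp)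
          have hws := ih (combR' a as rs) ws he (by simpa using hv) (by
              intro r hr
              simp only [combR', List.mem_map] at hr
              obtain ⟨r', hr', rfl⟩ := hr
              have := hl r' (by simp [hr'])
              cases r' with
              | nil => simp at this
              | cons b bs => simp [combL'] at this ⊢; omega) (by
              intro r hr
              simp only [combR', List.mem_map] at hr
              obtain ⟨r', hr', rfl⟩ := hr
              have h1 := hl r' (by simp [hr'])
              have h2 := hd r' (by simp [hr'])
              cases r' with
              | nil => simp at h1
              | cons b bs =>
                have h3 : (b : Kp) * w + dotL (cst bs) ws = 0 := h2
                simp only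
                rw [dot_comb _ _ _ _ _ (by simp at h1; omega)]
                rw [Nat.cast_sub (Nat.mod_lt _ (by norm_num)).le, ZMod.natCast_mod]
                rw [show ((10007 : ℕ) : Kp) = 0 from ZMod.natCast_self 10007]
                linear_combination (a : Kp) * h3 - (b : Kp) * h0)
          have hz : dotL (cst as) ws = 0 := by
            clear h0 ih he hl hd ha' hlas hv
            generalize cst as = z
            induction ws generalizing z with
            | nil => cases z <;> rfl
            | cons y ys ihy =>
              cases z with
              | nil => rfl
              | cons z zs =>
                rw [dotL, hws y (by simp), ihy (fun x hx => hws x (by simp [hx])) zs]; simp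
          have hw : w = 0 := by
            rw [hz, add_zero] at h0
            exact (mul_eq_zero.1 h0).resolve_left ha'
          intro x hx
          rcases List.mem_cons.1 hx with rfl | hx
          · exact hw
          · exact hws x hx

def redL (r : List ℤ) : List ℕ := r.map fun x => (x % 10007).toNat

lemma cst_redL (r : List ℤ) : cst (redL r) = r.map (Int.cast : ℤ → Kp) := by
  simp only [cst, redL, List.map_map]
  apply List.map_congr_left
  intro x _
  simp only [Function.comp]
  have h : (((x % 10007).toNat : ℤ) : Kp) = ((x % 10007 : ℤ) : Kp) := by
    rw [Int.toNat_of_nonneg (Int.emod_nonneg _ (by norm_num))]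
  rw [Int.cast_natCast] at h
  rw [h]
  have := ZMod.intCast_mod x 10007
  exact_mod_cast this

lemma det_of_elim (n : ℕ) (rows : List (List ℤ)) (h : elimB n (rows.map redL) = true)
    (hn : rows.length = n) (hl : ∀ r ∈ rows, r.length = n) :
    (Matrix.of fun i j : Fin n => (((rows.getD i []).getD j 0 : ℤ) : ℝ)).det ≠ 0 := by
  set M : Matrix (Fin n) (Fin n) ℤ := Matrix.of fun i j : Fin n => ((rows.getD i []).getD j 0) with hM
  intro hdet
  have e1 : (Matrix.of fun i j : Fin n => (((rows.getD i []).getD j 0 : ℤ) : ℝ)) = M.map (Int.castRingHom ℝ) := by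
    ext i j; simp [hM]
  rw [e1] at hdet
  have hd0 : M.det = 0 := by
    have := RingHom.map_det (Int.castRingHom ℝ) M
    rw [RingHom.mapMatrix_apply, hdet] at this
    simpa using this
  have hdp : (M.map (Int.castRingHom Kp)).det = 0 := by
    have := RingHom.map_det (Int.castRingHom Kp) M
    rw [RingHom.mapMatrix_apply, hd0] at this
    simpa using this.symm
  obtain ⟨w, hw, hMw⟩ := Matrix.exists_mulVec_eq_zero_iff.2 hdp
  apply hw
  have := elim_sound n (rows.map redL) (List.ofFn w) h (by simp) (by
      intro r hr
      obtain ⟨r', hr', rfl⟩ := List.mem_map.1 hr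
      simpa [redL] using hl r' hr') (by
      intro r hr
      obtain ⟨r', hr', rfl⟩ := List.mem_map.1 hr
      rw [cst_redL, dotL_sum n _ _ (by simpa using hl r' hr') (by simp)]
      obtain ⟨i, hi, rfl⟩ := List.getElem_of_mem hr'
      have := congrFun hMw ⟨i, hn ▸ hi⟩
      simp only [Matrix.mulVec, dotProduct, Pi.zero_apply] at this
      rw [← this]
      apply Finset.sum_congr rfl
      intro j _
      have hj : (j : ℕ) < (rows[i]).length := by rw [hl _ hr']; exact j.2
      simp [hM, hi, hj])
  ext i
  exact this (w i) (by simp [List.mem_ofFn])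


/-! ### Part 2b: monomials, weights, components -/

abbrev T3 := ℕ × ℕ × ℕ

noncomputable def mo (t : T3) : Fin 3 →₀ ℕ := Finsupp.equivFunOnFinite.symm ![t.1, t.2.1, t.2.2]
def un (m : Fin 3 →₀ ℕ) : T3 := (m 0, m 1, m 2)

lemma mo_un (m : Fin 3 →₀ ℕ) : mo (un m) = m := by
  ext k; fin_cases k <;> rfl
lemma un_mo (t : T3) : un (mo t) = t := rfl
lemma mo_add (s t : T3) : mo (s + t) = mo s + mo t := by
  ext k; fin_cases k <;> rfl
lemma un_add (s t : Fin 3 →₀ ℕ) : un (s + t) = un s + un t := rfl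
lemma mo_inj {s t : T3} : mo s = mo t ↔ s = t :=
  ⟨fun h => by rw [← un_mo s, h, un_mo], fun h => by rw [h]⟩

abbrev WT := ℕ × Bool × Bool

def wt (t : T3) : WT := (t.1 + t.2.1 + t.2.2, Nat.beq (t.1 % 2) 1, Nat.beq (t.2.1 % 2) 1)
def wadd (x y : WT) : WT := (x.1 + y.1, xor x.2.1 y.2.1, xor x.2.2 y.2.2)

lemma beq_add (a b : ℕ) : Nat.beq ((a + b) % 2) 1 = xor (Nat.beq (a % 2) 1) (Nat.beq (b % 2) 1) := by
  rcases Nat.mod_two_eq_zero_or_one a with h | h <;> rcases Nat.mod_two_eq_zero_or_one b with h' | h' <;>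
    rw [Nat.add_mod, h, h'] <;> rfl

lemma wt_add (s t : T3) : wt (s + t) = wadd (wt s) (wt t) := by
  simp only [wt, wadd, Prod.fst_add, Prod.snd_add, beq_add]
  congr 1
  omega

def evm (P t : T3) : ℕ := P.1 ^ t.1 * P.2.1 ^ t.2.1 * P.2.2 ^ t.2.2

noncomputable def rp (P : T3) : Fin 3 → ℝ := ![(P.1 : ℝ), P.2.1, P.2.2]

noncomputable def sp (c : ℝ) (s t : ℤˣ) (P : T3) : Fin 3 → ℝ :=
  ![c * ((s : ℤ) : ℝ) * P.1, c * ((t : ℤ) : ℝ) * P.2.1, c * P.2.2]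

lemma eval_eq3 (v : Fin 3 → ℝ) (g : PolyR) : eval v g =
    ∑ m ∈ g.support, coeff m g * (v 0 ^ m 0 * v 1 ^ m 1 * v 2 ^ m 2) := by
  rw [MvPolynomial.eval_eq']
  simp [Fin.prod_univ_three]

lemma eval_rp (P : T3) (g : PolyR) : eval (rp P) g = ∑ m ∈ g.support, coeff m g * (evm P (un m) : ℝ) := by
  rw [eval_eq3]
  simp [rp, evm, un]

noncomputable def comp (n : WT) (g : PolyR) : PolyR :=
  ∑ m ∈ g.support.filter (fun m => wt (un m) = n), monomial m (coeff m g)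

lemma coeff_comp (n : WT) (g : PolyR) (m : Fin 3 →₀ ℕ) :
    coeff m (comp n g) = if wt (un m) = n then coeff m g else 0 := by
  classical
  unfold comp
  rw [coeff_sum]
  simp only [coeff_monomial]
  rw [Finset.sum_ite_eq']
  simp only [Finset.mem_filter, mem_support_iff]
  split_ifs <;> tauto

lemma sum_comp (g : PolyR) : g = ∑ n ∈ g.support.image (fun m => wt (un m)), comp n g := by
  classical
  ext m
  rw [coeff_sum]
  simp only [coeff_comp]
  rw [Finset.sum_ite_eq]
  split_ifs with h
  · rfl
  · by_contra hc
    exact h (Finset.mem_image_of_mem (fun m => wt (un m)) (mem_support_iff.2 hc))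

/-- weight-homogeneous -/
def IsW (n : WT) (g : PolyR) : Prop := ∀ m, coeff m g ≠ 0 → wt (un m) = n

lemma isW_comp (n : WT) (g : PolyR) : IsW n (comp n g) := by
  intro m hm; rw [coeff_comp] at hm; by_contra h; simp [h] at hm

lemma isW_mul {n n' : WT} {g h : PolyR} (hg : IsW n g) (hh : IsW n' h) : IsW (wadd n n') (g * h) := by
  classical
  intro m hm
  rw [coeff_mul] at hm
  obtain ⟨x, hx, hne⟩ := Finset.exists_ne_zero_of_sum_ne_zero hm
  rw [← Finset.HasAntidiagonal.mem_antidiagonal.1 hx, un_add, wt_add, hg _ (left_ne_zero_of_mul hne),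
    hh _ (right_ne_zero_of_mul hne)]

noncomputable def chi (n : WT) : (ℝ × ℤˣ × ℤˣ) →* ℝ where
  toFun x := x.1 ^ n.1 * (bif n.2.1 then ((x.2.1 : ℤ) : ℝ) else 1) * (bif n.2.2 then ((x.2.2 : ℤ) : ℝ) else 1)
  map_one' := by rcases n with ⟨a, _ | _, _ | _⟩ <;> simp
  map_mul' x y := by rcases n with ⟨a, _ | _, _ | _⟩ <;> simp <;> ring

lemma chi_inj : Function.Injective chi := by
  intro n n' h
  have h1 := congrArg (fun f => f (2, 1, 1)) h
  have h2 := congrArg (fun f => f (1, -1, 1)) h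
  have h3 := congrArg (fun f => f (1, 1, -1)) h
  rcases n with ⟨a, i, j⟩
  rcases n' with ⟨a', i', j'⟩
  simp only [chi, MonoidHom.coe_mk, OneHom.coe_mk] at h1 h2 h3
  have e1 : a = a' := by
    have : (2 : ℝ) ^ a = 2 ^ a' := by
      revert h1; cases i <;> cases j <;> cases i' <;> cases j' <;> simp
    exact Nat.pow_right_injective (le_refl 2) (by exact_mod_cast this)
  have e2 : i = i' := by
    revert h2; cases i <;> cases i' <;> simp <;> norm_num
  have e3 : j = j' := by
    revert h3; cases j <;> cases j' <;> simp <;> norm_num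
  rw [e1, e2, e3]

lemma unit_pow (s : ℤˣ) (k : ℕ) : (((s : ℤ) : ℝ)) ^ k = bif Nat.beq (k % 2) 1 then ((s : ℤ) : ℝ) else 1 := by
  have h2 : (((s : ℤ) : ℝ)) ^ 2 = 1 := by
    rcases Int.units_eq_one_or s with rfl | rfl <;> simp
  conv_lhs => rw [← Nat.div_add_mod k 2, pow_add, pow_mul, h2, one_pow, one_mul]
  rcases Nat.mod_two_eq_zero_or_one k with h | h <;> rw [h]
  · rw [pow_zero]; rfl
  · rw [pow_one]; rfl

lemma eval_sp (P : T3) (c : ℝ) (s t : ℤˣ) (g : PolyR) : eval (sp c s t P) g =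
    ∑ m ∈ g.support, coeff m g * (evm P (un m) : ℝ) * chi (wt (un m)) (c, s, t) := by
  rw [eval_eq3]
  apply Finset.sum_congr rfl
  intro m _
  simp only [sp, Matrix.cons_val_zero, Matrix.cons_val_one, Matrix.cons_val, evm, un, wt, chi,
    MonoidHom.coe_mk, OneHom.coe_mk, mul_pow, unit_pow, pow_add]
  push_cast
  ring

def VI (orb : List T3) (g : PolyR) : Prop := ∀ P ∈ orb, ∀ (c : ℝ) (s t : ℤˣ), eval (sp c s t P) g = 0

lemma VI_mul {orb : List T3} {g : PolyR} (q : PolyR) (h : VI orb g) : VI orb (q * g) := by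
  intro P hP c s t; rw [map_mul, h P hP, mul_zero]

lemma VI_comp {orb : List T3} {g : PolyR} (h : VI orb g) (n : WT) :
    ∀ P ∈ orb, eval (rp P) (comp n g) = 0 := by
  classical
  intro P hP
  have hc : ∀ n, eval (rp P) (comp n g) =
      ∑ m ∈ g.support with wt (un m) = n, coeff m g * (evm P (un m) : ℝ) := by
    intro n
    simp only [comp, map_sum, eval_monomial, Finsupp.prod_fintype, pow_zero, implies_true,
      Fin.prod_univ_three]
    apply Finset.sum_congr rfl
    intro m _
    simp [rp, evm, un]
  have li := (linearIndependent_monoidHom (ℝ × ℤˣ × ℤˣ) ℝ).comp chi chi_inj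
  rw [linearIndependent_iff'] at li
  have key := li (g.support.image (fun m => wt (un m))) (fun n => eval (rp P) (comp n g)) (by
    ext ⟨c, s, t⟩
    have := h P hP c s t
    rw [eval_sp] at this
    simp only [Function.comp, Finset.sum_apply, Pi.smul_apply, smul_eq_mul, Pi.zero_apply]
    rw [← this]
    rw [← Finset.sum_fiberwise_of_maps_to (g := fun m => wt (un m))
      (t := g.support.image (fun m => wt (un m))) (fun m hm => Finset.mem_image_of_mem _ hm)]
    apply Finset.sum_congr rfl
    intro n _
    rw [hc, Finset.sum_mul]
    apply Finset.sum_congr rfl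
    intro m hm
    rw [(Finset.mem_filter.1 hm).2])
  by_cases hn : n ∈ g.support.image (fun m => wt (un m))
  · exact key n hn
  · rw [hc]
    apply Finset.sum_eq_zero
    intro m hm
    exact absurd (Finset.mem_image.2 ⟨m, (Finset.mem_filter.1 hm).1, (Finset.mem_filter.1 hm).2⟩) hn

lemma VI_of_isW {orb : List T3} {g : PolyR} {n : WT} (hw : IsW n g)
    (h : ∀ P ∈ orb, eval (rp P) g = 0) : VI orb g := by
  intro P hP c s t
  rw [eval_sp]
  have : ∀ m ∈ g.support, coeff m g * (evm P (un m) : ℝ) * chi (wt (un m)) (c, s, t)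
     = coeff m g * (evm P (un m) : ℝ) * chi n (c, s, t) := by
    intro m hm; rw [hw m (mem_support_iff.1 hm)]
  rw [Finset.sum_congr rfl this, ← Finset.sum_mul, ← eval_rp, h P hP, zero_mul]

/-! lists of monomials -/

def monos (n : WT) : List T3 :=
  ((List.range (n.1 + 1)).flatMap fun k => (List.range (n.1 + 1 - k)).map fun l =>
    (k, l, n.1 - k - l)).filter fun t => decide (wt t = n)

lemma mem_monos (t : T3) (n : WT) (h : wt t = n) : t ∈ monos n := by
  subst h
  unfold monos
  rw [List.mem_filter]
  refine ⟨?_, by simp⟩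
  rw [List.mem_flatMap]
  refine ⟨t.1, by simp [wt]; omega, ?_⟩
  rw [List.mem_map]
  refine ⟨t.2.1, by simp [wt]; omega, ?_⟩
  ext <;> simp [wt] <;> omega

lemma wt_of_mem_monos {t : T3} {n : WT} (h : t ∈ monos n) : wt t = n := by
  have := (List.mem_filter.1 h).2
  simpa using this

abbrev LP := List (T3 × ℤ)

noncomputable def toPoly (L : LP) : PolyR := (L.map fun x => monomial (mo x.1) (x.2 : ℝ)).sum

@[simp] lemma toPoly_nil : toPoly [] = 0 := rfl
@[simp] lemma toPoly_cons (x : T3 × ℤ) (L : LP) : toPoly (x :: L) = monomial (mo x.1) (x.2 : ℝ) + toPoly L := by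
  simp [toPoly]

def cfL (t : T3) : LP → ℤ
  | [] => 0
  | x :: L => (if x.1 = t then x.2 else 0) + cfL t L

lemma coeff_toPoly (t : T3) (L : LP) : coeff (mo t) (toPoly L) = (cfL t L : ℝ) := by
  classical
  induction L with
  | nil => simp [cfL]
  | cons x L ih => 
    rw [toPoly_cons, coeff_add, ih, coeff_monomial, cfL]
    simp only [mo_inj]
    push_cast
    rfl

def evL (P : T3) : LP → ℤ
  | [] => 0
  | x :: L => x.2 * (evm P x.1 : ℤ) + evL P L

lemma eval_toPoly (P : T3) (L : LP) : eval (rp P) (toPoly L) = (evL P L : ℝ) := by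
  induction L with
  | nil => simp [evL]
  | cons x L ih =>
    rw [toPoly_cons, map_add, ih, eval_monomial, evL, Finsupp.prod_fintype _ _ (by simp),
      Fin.prod_univ_three]
    push_cast
    simp [rp, evm, mo]

def shL (s : T3) (L : LP) : LP := L.map fun x => (s + x.1, x.2)

lemma toPoly_shL (s : T3) (L : LP) : toPoly (shL s L) = monomial (mo s) 1 * toPoly L := by
  induction L with
  | nil => simp [shL]
  | cons x L ih =>
    have : shL s (x :: L) = (s + x.1, x.2) :: shL s L := rfl
    rw [this, toPoly_cons, ih, toPoly_cons, mul_add, monomial_mul, mo_add, one_mul]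

lemma isW_toPoly {n : WT} {L : LP} (h : ∀ x ∈ L, wt x.1 = n) : IsW n (toPoly L) := by
  classical
  intro m hm
  induction L with
  | nil => simp at hm
  | cons x L ih =>
    rw [toPoly_cons, coeff_add, coeff_monomial] at hm
    by_cases hx : mo x.1 = m
    · rw [← hx, un_mo]; exact h x (by simp)
    · simp only [hx, if_false, zero_add] at hm
      exact ih (fun x hx => h x (by simp [hx])) hm

/-! linear functional -/

noncomputable def Lam (lam : T3 → ℤ) : PolyR →ₗ[ℝ] ℝ :=
  (basisMonomials (Fin 3) ℝ).constr ℝ fun m => (lam (un m) : ℝ)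

lemma Lam_monomial (lam : T3 → ℤ) (m : Fin 3 →₀ ℕ) (c : ℝ) : Lam lam (monomial m c) = c * lam (un m) := by
  have : monomial m c = c • basisMonomials (Fin 3) ℝ m := by
    rw [coe_basisMonomials, smul_monomial, smul_eq_mul, mul_one]
  rw [this, map_smul, Lam, Module.Basis.constr_basis, smul_eq_mul]

def lamL (lam : T3 → ℤ) : LP → ℤ
  | [] => 0
  | x :: L => x.2 * lam x.1 + lamL lam L

lemma Lam_toPoly (lam : T3 → ℤ) (L : LP) : Lam lam (toPoly L) = (lamL lam L : ℝ) := by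
  induction L with
  | nil => simp [lamL]
  | cons x L ih => rw [toPoly_cons, map_add, ih, Lam_monomial, lamL, un_mo]; push_cast; rfl

def WN : WT := (33, false, true)

lemma Lam_isW {lam : T3 → ℤ} (hl : ∀ t, wt t ≠ WN → lam t = 0) {n : WT} (hn : n ≠ WN) {g : PolyR}
    (hg : IsW n g) : Lam lam g = 0 := by
  conv_lhs => rw [g.as_sum, map_sum]
  apply Finset.sum_eq_zero
  intro m hm
  rw [Lam_monomial, hl _ (by rw [hg m (mem_support_iff.1 hm)]; exact hn)]
  simp

def wL (t : T3) : List (T3 × ℤ) → ℤ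
  | [] => 0
  | x :: L => x.2 * (evm x.1 t : ℤ) + wL t L

def wcomp (n : WT) : WT := (33 - n.1, n.2.1, !n.2.2)

lemma wcomp_eq {x y : WT} (h : wadd x y = WN) : y = wcomp x := by
  rcases x with ⟨a, i, j⟩
  rcases y with ⟨b, k, l⟩
  simp only [wadd, WN, wcomp, Prod.mk.injEq] at h ⊢
  obtain ⟨h1, h2, h3⟩ := h
  refine ⟨by omega, ?_, ?_⟩
  · revert h2; cases i <;> cases k <;> simp
  · revert h3; cases j <;> cases l <;> simp

lemma Lam_gen {lam : T3 → ℤ} (hl : ∀ t, wt t ≠ WN → lam t = 0) {orb : List T3} (n : WT) (L W : LP)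
    (hL : ∀ x ∈ L, wt x.1 = n) (hW : ∀ x ∈ W, x.1 ∈ orb)
    (hc : ∀ t ∈ monos (wcomp n), lamL lam (shL t L) = wL t W) (h : PolyR) (hh : VI orb h) :
    Lam lam (toPoly L * h) = 0 := by
  have e1 : Lam lam (toPoly L * h) = ∑ m ∈ h.support, coeff m h * (lamL lam (shL (un m) L) : ℝ) := by
    conv_lhs => rw [h.as_sum, Finset.mul_sum, map_sum]
    apply Finset.sum_congr rfl
    intro m _
    have : monomial m (coeff m h) = (coeff m h) • monomial (mo (un m)) (1 : ℝ) := by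
      rw [mo_un, smul_monomial, smul_eq_mul, mul_one]
    rw [this, mul_smul_comm, map_smul, mul_comm (toPoly L), ← toPoly_shL, Lam_toPoly, smul_eq_mul]
  have e2 : ∀ m ∈ h.support, coeff m h * (lamL lam (shL (un m) L) : ℝ) =
      if wt (un m) = wcomp n then coeff m h * (wL (un m) W : ℝ) else 0 := by
    intro m _
    split_ifs with hm
    · rw [hc _ (mem_monos _ _ hm)]
    · have : lamL lam (shL (un m) L) = 0 := by
        clear hc e1
        induction L with
        | nil => rfl
        | cons x L ih =>
          have h1 : lamL lam (shL (un m) (x :: L)) = x.2 * lam (un m + x.1) + lamL lam (shL (un m) L) := rfl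
          rw [h1, ih (fun x hx => hL x (by simp [hx]))]
          rw [hl, mul_zero, add_zero]
          intro hwt
          rw [add_comm, wt_add, hL x (by simp)] at hwt
          exact hm (wcomp_eq hwt)
      rw [this]; simp
  rw [e1, Finset.sum_congr rfl e2, ← Finset.sum_filter]
  have e3 : ∀ W : LP, (∀ x ∈ W, x.1 ∈ orb) →
      ∑ m ∈ h.support with wt (un m) = wcomp n, coeff m h * (wL (un m) W : ℝ) = 0 := by
    intro W
    induction W with
    | nil => intro _; simp [wL]
    | cons x W ih =>
      intro hW
      simp only [wL]
      push_cast
      simp only [mul_add, Finset.sum_add_distrib]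
      rw [ih (fun y hy => hW y (by simp [hy])), add_zero]
      have := VI_comp hh (wcomp n) x.1 (hW x (by simp))
      have hcc : eval (rp x.1) (comp (wcomp n) h) =
          ∑ m ∈ h.support with wt (un m) = wcomp n, coeff m h * (evm x.1 (un m) : ℝ) := by
        simp only [comp, map_sum, eval_monomial, Finsupp.prod_fintype, pow_zero, implies_true,
          Fin.prod_univ_three]
        apply Finset.sum_congr rfl
        intro m _
        simp [rp, evm, un]
      rw [hcc] at this
      calc _ = (x.2 : ℝ) * ∑ m ∈ h.support with wt (un m) = wcomp n, coeff m h * (evm x.1 (un m) : ℝ) := by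
            rw [Finset.mul_sum]; apply Finset.sum_congr rfl; intro m _; ring
        _ = 0 := by rw [this, mul_zero]
  exact e3 W hW


structure Cls where
  n : WT
  fr : List T3
  sel : List (ℕ × T3)
  pts : List ℕ

def pivOf (d : Cls) : List T3 := (monos d.n).filter fun t => decide (t ∉ d.fr)

def bL (gens : List LP) (x : ℕ × T3) : LP := shL x.2 (gens.getD x.1 [])
def oAt (orb : List T3) (q : ℕ) : T3 := orb.getD q (0, 0, 1)

def rows0 (orb : List T3) (d : Cls) (piv : List T3) : List (List ℤ) :=
  d.pts.map fun q => piv.map fun t => (evm (oAt orb q) t : ℤ)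
def rows1 (gens : List LP) (d : Cls) : List (List ℤ) :=
  d.fr.map fun e => d.sel.map fun x => cfL e (bL gens x)

def chkCls (orb : List T3) (gens : List LP) (d : Cls) : Bool :=
  elimB d.pts.length ((rows0 orb d (pivOf d)).map redL) &&
  (elimB d.fr.length ((rows1 gens d).map redL) &&
  (decide ((pivOf d).length = d.pts.length) && (decide (d.sel.length = d.fr.length) &&
  (decide ((pivOf d).Nodup) &&
  (decide (∀ x ∈ d.sel, ∀ y ∈ bL gens x, wt y.1 = d.n) && decide (∀ x ∈ d.sel, x.1 < gens.length))))))

set_option maxHeartbeats 1000000 in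
lemma cls_mem (orb : List T3) (gens : List LP) (d : Cls) (h0 : (0, 0, 1) ∈ orb)
    (hv : ∀ L ∈ gens, ∀ P ∈ orb, evL P L = 0) (hc : chkCls orb gens d = true)
    (g : PolyR) (hg : IsW d.n g) (hgv : ∀ P ∈ orb, eval (rp P) g = 0) :
    g ∈ Ideal.span {p | ∃ L ∈ gens, p = toPoly L} := by
  classical
  simp only [chkCls, Bool.and_eq_true, decide_eq_true_eq] at hc
  obtain ⟨c0, c1, cl, cs, cn, cw, cx⟩ := hc
  have D1 := det_of_elim _ (rows1 gens d) c1 (by simp [rows1]) (by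
    intro r hr; simp only [rows1, List.mem_map] at hr; obtain ⟨e, _, rfl⟩ := hr; simpa using cs)
  have D0 := det_of_elim _ (rows0 orb d (pivOf d)) c0 (by simp [rows0]) (by
    intro r hr; simp only [rows0, List.mem_map] at hr; obtain ⟨e, _, rfl⟩ := hr; simpa using cl)
  set A1 := (Matrix.of fun i j : Fin d.fr.length => ((((rows1 gens d).getD i []).getD j 0 : ℤ) : ℝ)) with hA1
  set A0 := (Matrix.of fun i j : Fin d.pts.length =>
    ((((rows0 orb d (pivOf d)).getD i []).getD j 0 : ℤ) : ℝ)) with hA0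
  let c : Fin d.fr.length → ℝ := fun i => coeff (mo d.fr[i]) g
  let y : Fin d.fr.length → ℝ := A1⁻¹.mulVec c
  have hy : A1.mulVec y = c := by
    simp only [y, Matrix.mulVec_mulVec]
    rw [Matrix.mul_nonsing_inv _ (isUnit_iff_ne_zero.2 D1), Matrix.one_mulVec]
  let q : PolyR := ∑ k : Fin d.fr.length, C (y k) * toPoly (bL gens (d.sel[(k : ℕ)]'(by rw [cs]; exact k.2)))
  have hbl : ∀ x ∈ d.sel, toPoly (bL gens x) = monomial (mo x.2) 1 * toPoly (gens.getD x.1 []) := by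
    intro x _; rw [bL, toPoly_shL]
  have hgm : ∀ x ∈ d.sel, gens.getD x.1 [] ∈ gens := by
    intro x hx
    have := cx x hx
    rw [List.getD_eq_getElem _ _ this]
    exact List.getElem_mem this
  have hq : q ∈ Ideal.span {p | ∃ L ∈ gens, p = toPoly L} := by
    refine Ideal.sum_mem _ fun k _ => Ideal.mul_mem_left _ _ ?_
    rw [hbl _ (List.getElem_mem _)]
    exact Ideal.mul_mem_left _ _ (Ideal.subset_span ⟨_, hgm _ (List.getElem_mem _), rfl⟩)
  have hqc : ∀ m, coeff m q = ∑ k : Fin d.fr.length, y k *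
      coeff m (toPoly (bL gens (d.sel[(k : ℕ)]'(by rw [cs]; exact k.2)))) := by
    intro m; simp only [q, coeff_sum, coeff_C_mul]
  have hqv : ∀ P ∈ orb, eval (rp P) q = 0 := by
    intro P hP
    simp only [q, map_sum, map_mul]
    apply Finset.sum_eq_zero
    intro k _
    rw [hbl _ (List.getElem_mem _), map_mul, eval_toPoly, hv _ (hgm _ (List.getElem_mem _)) P hP]
    simp
  have hqw : IsW d.n q := by
    intro m hm
    rw [hqc] at hm
    obtain ⟨k, _, hk⟩ := Finset.exists_ne_zero_of_sum_ne_zero hm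
    exact isW_toPoly (cw _ (List.getElem_mem _)) m (right_ne_zero_of_mul hk)
  suffices hz : g - q = 0 by rw [sub_eq_zero.1 hz]; exact hq
  have hw : IsW d.n (g - q) := by
    intro m hm
    rw [coeff_sub] at hm
    by_cases h : coeff m g = 0
    · exact hqw m (by intro h'; rw [h, h'] at hm; simp at hm)
    · exact hg m h
  have hfr : ∀ t ∈ d.fr, coeff (mo t) (g - q) = 0 := by
    intro t ht
    obtain ⟨i, hi, rfl⟩ := List.getElem_of_mem ht
    have := congrFun hy ⟨i, hi⟩
    simp only [Matrix.mulVec, dotProduct, c] at this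
    rw [coeff_sub, hqc, sub_eq_zero]
    simp only [Fin.getElem_fin] at this
    rw [← this]
    apply Finset.sum_congr rfl
    intro k _
    have hk : (k : ℕ) < d.sel.length := by rw [cs]; exact k.2
    rw [mul_comm, coeff_toPoly]
    simp [hA1, rows1, hi, hk]
  let v : Fin d.pts.length → ℝ := fun j => coeff (mo ((pivOf d)[(j : ℕ)]'(by rw [cl]; exact j.2))) (g - q)
  have hv0 : v = 0 := by
    apply Matrix.eq_zero_of_mulVec_eq_zero D0
    ext i
    have hP : oAt orb d.pts[i] ∈ orb := by
      unfold oAt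
      by_cases h : d.pts[i] < orb.length
      · rw [List.getD_eq_getElem _ _ h]; exact List.getElem_mem h
      · rw [List.getD_eq_default _ _ (not_lt.1 h)]; exact h0
    have he : eval (rp (oAt orb d.pts[i])) (g - q) = 0 := by
      rw [map_sub, hgv _ hP, hqv _ hP, sub_zero]
    rw [eval_rp] at he
    generalize hPP : oAt orb d.pts[i] = P at *
    have e1 : ∑ m ∈ (g - q).support, coeff m (g - q) * (evm P (un m) : ℝ) =
        ∑ t ∈ (pivOf d).toFinset, coeff (mo t) (g - q) * (evm P t : ℝ) := by
      have e2 : ∑ t ∈ (pivOf d).toFinset, coeff (mo t) (g - q) * (evm P t : ℝ) =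
          ∑ m ∈ (pivOf d).toFinset.image mo, coeff m (g - q) * (evm P (un m) : ℝ) := by
        rw [Finset.sum_image (fun a _ b _ h => mo_inj.1 h)]
        rfl
      rw [e2]
      apply Finset.sum_subset
      · intro m hm
        rw [mem_support_iff] at hm
        rw [Finset.mem_image]
        refine ⟨un m, ?_, mo_un m⟩
        rw [List.mem_toFinset, pivOf, List.mem_filter]
        refine ⟨mem_monos _ _ (hw m hm), ?_⟩
        rw [decide_eq_true_eq]
        intro hin
        have := hfr _ hin
        rw [mo_un] at this
        exact hm this
      · intro m _ hm
        rw [notMem_support_iff.1 hm, zero_mul]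
    rw [e1, List.sum_toFinset _ cn, ← Fin.sum_univ_fun_getElem] at he
    simp only [Matrix.mulVec, dotProduct, Pi.zero_apply]
    rw [← he]
    refine Fintype.sum_equiv (finCongr cl.symm) _ _ ?_
    intro j
    have hj : (j : ℕ) < (pivOf d).length := by rw [cl]; exact j.2
    simp only [Fin.getElem_fin] at hPP
    rw [mul_comm]
    simp [hA0, rows0, hj, v, hPP]
  ext m
  rw [coeff_zero]
  by_contra hm
  have hwm := hw m hm
  by_cases hin : un m ∈ d.fr
  · have := hfr _ hin
    rw [mo_un] at this
    exact hm this
  · have : un m ∈ pivOf d := by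
      rw [pivOf, List.mem_filter]
      exact ⟨mem_monos _ _ hwm, by simpa using hin⟩
    obtain ⟨j, hj, hjm⟩ := List.getElem_of_mem this
    have := congrFun hv0 ⟨j, by rw [← cl]; exact hj⟩
    simp only [v, Pi.zero_apply, Fin.getElem_fin, hjm, mo_un] at this
    exact hm this


/-! ### Part 2c: explicit data -/

def orbL : List T3 :=
   [(0,0,1), (0,1,0), (0,1,1), (0,2,1), (0,4,1), (1,0,0), (1,0,1), (1,1,1), (2,0,1), (2,1,0),
   (2,1,1), (2,1,2), (2,2,1), (2,3,0), (2,3,1), (2,3,2), (2,3,3), (2,3,4), (2,5,1), (2,5,2), (2,5,4),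
   (2,7,2), (2,9,2), (4,0,1), (4,0,3), (4,1,1), (4,2,1), (4,3,1), (4,4,1), (4,6,1), (4,8,1), (6,1,1),
   (6,1,2), (6,1,4), (6,5,2), (6,7,1), (8,0,1), (10,1,1), (10,3,2)]

def gen0 : LP :=
   [((0,1,13),6291456), ((0,3,11),-15335424), ((0,5,9),16400384), ((0,7,7),-9371648),
   ((0,9,5),2196480), ((0,11,3),-186368), ((0,13,1),5120), ((2,1,11),-11501568), ((2,5,7),17571840),
   ((2,7,5),-6809088), ((2,9,3),768768), ((2,11,1),-29952), ((4,1,9),15375360), ((4,3,7),-15814656),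
   ((4,5,5),768768), ((4,7,3),-384384), ((4,9,1),54912), ((6,1,7),-6369792), ((6,3,5),6246240),
   ((6,5,3),192192), ((6,7,1),-68640), ((8,1,5),684684), ((8,3,3),-720720), ((8,5,1),36036),
   ((10,1,3),-15015), ((10,3,1),15015)]

def gen1 : LP :=
   [((1,0,13),-3145728), ((1,2,11),7667712), ((1,6,7),-1757184), ((3,0,11),5750784),
   ((3,2,9),-20500480), ((3,4,7),2489344), ((3,6,5),2306304), ((5,0,9),-3075072), ((5,2,7),16363776),
   ((5,4,5),-3267264), ((5,6,3),-576576), ((7,0,7),466752), ((7,2,5),-3740880), ((7,4,3),816816),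
   ((7,6,1),27456), ((9,0,5),5148), ((9,2,3),212212), ((9,4,1),-38896), ((11,0,3),-1911),
   ((11,2,1),-2340), ((13,0,1),27)]

def gen2 : LP :=
   [((1,5,8),16400384), ((1,7,6),-12886016), ((1,9,4),2196480), ((1,11,2),-186368), ((1,13,0),5120),
   ((3,3,8),-41000960), ((3,5,6),22550528), ((3,7,4),-2196480), ((3,9,2),768768), ((3,11,0),-29952),
   ((5,1,8),9225216), ((5,3,6),16912896), ((5,5,4),-5765760), ((5,7,2),-1537536), ((5,9,0),54912),
   ((7,1,6),-5436288), ((7,3,4),-1235520), ((7,5,2),1825824), ((7,7,0),-13728), ((9,1,4),694980),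
   ((9,3,2),-296296), ((9,5,0),-41756), ((11,1,2),-18837), ((11,3,0),10335), ((13,1,0),54)]

def gen3 : LP :=
   [((0,1,14),8570940751872), ((0,3,12),-28635724402688), ((0,5,10),35164088960000),
   ((0,7,8),-18878104227840), ((0,9,6),4092845419520), ((0,11,4),-322301837312),
   ((0,13,2),8255336448), ((2,1,12),-893368359936), ((2,3,10),-10160467629312),
   ((2,5,8),17197107086016), ((2,7,6),-6644239833088), ((2,9,4),508420680768),
   ((2,11,2),-6952757760), ((2,13,0),-499186688), ((4,1,10),-1071151361280), ((4,3,8),-4904231904),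
   ((4,5,6),776642122256), ((4,7,4),322909418832), ((4,9,2),-25053215616), ((4,11,0),1557267712),
   ((6,1,8),157835399436), ((6,3,6),11651391752), ((6,5,4),-169659494004), ((6,7,2),1226747808),
   ((6,9,0),-1054044992), ((8,1,6),-159125967), ((8,3,4),-5763390633), ((8,5,2),5748534792),
   ((8,7,0),173981808)]

def gen4 : LP :=
   [((0,1,14),25277624156160), ((0,3,12),-84254947192832), ((0,5,10),103356448971776),
   ((0,7,8),-55482539633664), ((0,9,6),12025124224256), ((0,11,4),-945903655424),
   ((0,13,2),24193129728), ((2,1,12),-3144377852928), ((2,3,10),-29222028675840),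
   ((2,5,8),50329057027392), ((2,7,6),-19411132421824), ((2,9,4),1469377413504),
   ((2,11,2),-19446875136), ((2,13,0),-1448615168), ((4,1,10),-2577038720256),
   ((4,3,8),-523185762528), ((4,5,6),2172454155872), ((4,7,4),998882652768), ((4,9,2),-75507116256),
   ((4,11,0),4394790400), ((6,1,8),263133404820), ((6,3,6),271877065460), ((6,5,4),-535273434696),
   ((6,7,2),2836959840), ((6,9,0),-2573995424), ((8,1,6),16128082971), ((8,3,4),-36689873220),
   ((8,5,2),20561790249), ((10,1,4),-97864767), ((10,5,0),97864767)]

def gen5 : LP :=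
   [((0,1,14),4791637027454976), ((0,3,12),-15918173054377984), ((0,5,10),19501772574828544),
   ((0,7,8),-10471975822184448), ((0,9,6),2270904457169920), ((0,11,4),-178739646711808),
   ((0,13,2),4574463820800), ((2,1,12),-702983624398848), ((2,3,10),-5447516116922880),
   ((2,5,8),9567718601950080), ((2,7,6),-3695088496656128), ((2,9,4),282072901638528),
   ((2,11,2),-3933100035072), ((2,13,0),-270165575680), ((4,1,10),-333908561226240),
   ((4,3,8),-263821904888256), ((4,5,6),426607737363808), ((4,7,4),183817012675296),
   ((4,9,2),-13510429815168), ((4,11,0),816145890560), ((6,1,8),-9188402518152),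
   ((6,3,6),113062170981760), ((6,5,4),-102928639822008), ((6,7,2),-476126988480),
   ((6,9,0),-469001653120), ((8,1,6),8203765724154), ((8,3,4),-13071045937950),
   ((8,5,2),4867280213796), ((12,1,2),-4403914515), ((12,3,0),4403914515)]

def gen6 : LP :=
   [((1,0,14),7864320), ((1,2,12),-19824640), ((1,4,10),4022272), ((1,6,8),19054592),
   ((1,8,6),-13139968), ((1,10,4),2204672), ((1,12,2),-186368), ((1,14,0),5120),
   ((3,0,12),-14868480), ((3,2,10),48396288), ((3,4,8),-52227584), ((3,6,6),19912704),
   ((3,8,4),-1943040), ((3,10,2),760064), ((3,12,0),-29952), ((5,0,10),8616960), ((5,2,8),-26704128),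
   ((5,4,6),25368448), ((5,6,4),-5800704), ((5,8,2),-1536000), ((5,10,0),55424), ((7,0,8),-1705440),
   ((7,2,6),2406976), ((7,4,4),-2531616), ((7,6,2),1844832), ((7,8,0),-14752), ((9,0,6),93720),
   ((9,2,4),200268), ((9,4,2),-251784), ((9,6,0),-42204), ((11,0,4),-1080), ((11,2,2),-9639),
   ((11,4,0),10719)]

def gensL : List LP := [gen0, gen1, gen2, gen3, gen4, gen5, gen6]

def gwt : List WT := [(14,false,true), (14,true,false), (14,true,true), (15,false,true), (15,false,true), (15,false,true), (15,true,false)]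

def wgt0 : List ℤ :=
   [-348496845833205243312738969600, 0, 309783773041587642137492275200,
   -929332881487034358340530585600, -193611037852954717404837120000, 0,
   1925904573037176533884895599001600, 589589599152325288494626431303680,
   137056827370501341551001600, 0, -624885329024311263976488960, -4811791180295810299704901632,
   551734924367689695860097024, 0, -92186140421686099930251264, 25121540651959742921441280,
   23867850523410432, -85261811712000, 251698657817852588851200, -9509957665341610880139264,
   -32554509926400, 486574578483484434628608, -15591324637587998507008, -150070436719193056204908,
   -9323379110707200, 252906629672445330751488, -148360932228986996992704, 56839632398056983724032,
   -11547858829526815550832, 338175235339112580288, -14182602083001050148, -194920779274518528,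
   13596594536448000, 22373826822144, -323728441344000, 50226958172160, 51157087027200,
   4227858432000, 5934415872000]

def wgt1 : List ℤ :=
   [0, 0, 0, 0, 0, 0, 0, -608625979037535694749696, 0, 0, 0, 869082725225594880, 0, 0, 0,
   1513566250469425152, 0, 0, 0, -1245493586439438336, 0, 585062558711414784, -106225288599306240, 0,
   0, 257752502146865037312, 10658306182311051264, -163545569531466350592, 31073788877284048896,
   20841947209068969984, -4722405585079762944, 0, 0, 0, 0, 0, 0, 0, 0]

def wgt2 : List ℤ :=
   [0, 0, 0, 0, 0, -160241172822069111372644352000000, 1925904573037176533884895599001600,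
   589589597935073330419555041804288, 274113654741002683102003200, -3626440185658893926400000,
   -1249770658048622527952977920, -4811791179426727574479306752, 1103469848735379391720194048,
   -9327263852003328000000, -184372280843372199860502528, 25121545192658494329716736,
   15911900348940288, -42630905856000, 503397315635705177702400, -9509963892809543077330944,
   -16277254963200, 486578673921395414532096, -15592280665185392263168, -600281746876772224819632,
   -12431172147609600, 1012142023694075053080576, -593401095691218743765760,
   226377256175039136792576, -45942845007088989812160, 1602804307865277960960,
   -132288897693280407696, -1169524675647111168, 40789783609344000, 33560740233216, -971185324032000,
   301361749032960, 409256696217600, 42278584320000, 29672079360000]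

def wgt3 : List ℤ :=
   [-474761496152432046018633921500875200, -253068553349261001238145352597504000,
   14850529223823837299761758821376000, -1421150195194003782342749012770425600,
   8039813056576480752459367076164800, 15623097723102400979143255444684800000,
   2917500841900091172500719698733611089920, 893153365617999850410380880066530770944,
   6577502551630270775998084546560, 707136978714518889399582720000,
   -327067001457582456970448338944000, -14578505098455435098627858376425472,
   320489600680036790572825096224768, 1818767949368618542694400000,
   -35224495939538307182905356976128, 76111891330686903570832510943232, 112348709260552921153536,
   -541581680857998950400, 963481816713552079568940564480, -28812757780530793123647681724416,
   -206785732691235962880, 1474195564380441325597919281152, -47238084940783540705738620928,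
   -7932007095696780846863286096, -40250193664870428180480, 13198863601890833456050864128,
   -7750096181777941578988676352, 2974850205691578184846934016, -555558332901302450963783232,
   20037364968649442853027072, 48681341073178012030125456, 369869195821452789547008,
   19984106051899018444800, 124667074922120478720, -475812048854738534400, -95307461302167797760,
   -236727537637565399040, -34403646677660467200, -9792552915330662400]

def wgt4 : List ℤ :=
   [-1400178088796825942507794758708456000, -757476126710517899293324795183104000,
   53084891036261280863493997632000000, -4190793601761905741518997481651820800,
   48801192085315015700132669160916800, 45337459665655992163807404018892800000,
   8555422784708648488153451749674235985920, 2619126803673238754336906737545155444736,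
   24461684924564307361944211292160, 2052076663589925709330513920000,
   -957676276694295235349526510305280, -42750724488379482782609239356997632,
   929764089584001263869195997675520, 5277974957793018799718400000,
   -100132972294941410538180457267200, 223194248781877038464341760802816, 329338588228473644384256,
   -1587400143100339814400, 2865066903327041057830828769280, -84491946206697259814053704892416,
   -606098236456493383680, 4323003353128471930792445214720, -138523311353496541805765459968,
   -29951585269905813342578945811, -118096332591759391457280, 49981955228964650384607780864,
   -29350782812347864665935184432, 11254568737588969076490264576, -2137367100563703851822497980,
   78638102148563754479254704, 142623594254101858640060751, 1064336602985318798327808,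
   59249249129492958412800, 365912499057202298880, -1410696407845070438400, -274257009633405173760,
   -684608128713951805440, -99642355030897459200, -27869151595226726400]

def wgt5 : List ℤ :=
   [-265418352091681210471194503173771401600, -141914657413859023299608548988682240000,
   12687543833620979881383489691943731200, -792683814040159748917407934301114457600,
   7532223336230718618729704324446128000, 8455400137326693688034471945699328000000,
   1619075719592736464111149660251077004492800, 495658101428739692802378061901926854819840,
   6014304931644677668524541555507200, 382710664229539514741371699200000,
   -185386163291142764026946787276226560, -8090384514710652377638461752359256064,
   179318657144840535262982414945746944, 984338128162395871248384000000,
   -19611690155479117785355801076957184, 42238519108824735384209168762142720,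
   62294953254480781693157376, -300209665125963005952000, 539044591694307642114622488576000,
   -15989725116354215439885597564469248, -114625508502640420454400,
   818109175957627017773948336603136, -26214919514795802363448004182016,
   -7416911153433224070006588591228, -22366109798838510708326400, 12407206243527878749164084953088,
   -7283489886940340852889032793024, 2791343221333101693041275011072,
   -539269228073540973272898321072, 19144026026066822396686577088, 26453713082693314483346629932,
   196119881034291975334920192, 11381696750400458194944000, 69334239275556060266496,
   -270992779771439480832000, -50535941309599045386240, -127054750721238053683200,
   -18531639703287889920000, -5052773947476541440000]

def wgt6 : List ℤ :=
   [0, 0, 0, 0, 0, 0, 0, 589589599414679494396942101774336, 0, -3626440185658893926400000,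
   -1405969881234828928651100160, -4811791182592149680314908672, 2311202469541524530616336384,
   -27981791556009984000000, -570401640222917721059229696, 75364629341310654672273408,
   47735701046820864, -127892717568000, 2422601002794180044390400, -47549816719005455147335680,
   -81386274816000, 3406050132557418410803200, -140330419769717400010752, 0, 0,
   1011709194566675846529024, -1186744642340814337955328, 679454340539448788385792,
   -183901729952566627981056, 9606414094140499063296, -1066575529507685696640, -1169524675647111168,
   40789783609344000, 33560740233216, -4855926620160000, 2109532243230720, 0, 42278584320000,
   89016238080000]

def wgtL : List LP := [orbL.zip wgt0, orbL.zip wgt1, orbL.zip wgt2, orbL.zip wgt3, orbL.zip wgt4, orbL.zip wgt5, orbL.zip wgt6]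

def lamT : List (List ℤ) :=
   [[0, 0, 0, 0, 0, 0, 0, -7691202231359727734990776440, -252067219358940766547192279700,
   -5980278715981108529749890017040, -126118272699751575916607754245580,
   -2501253834930798558247993567365000, -47732577695403324174957833600357700,
   -887512254865747586681245407037670400, -16207482051450731615278626960365735100,
   -292327397068676880989245183782625351800], [0, 0, 0, 0, 0, 0, 226871308973634858543890880,
   1837548234383295990247211520, 9976441687295474019262233600, 51988775425262218268639907840,
   278845116455192687805535764480, 1398759149206514290058448076800, 5239715341274123719833118310400,
   -526805478640628132457522660249600, -44429224594845426554760126378393600,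
   -2177003505422494751955321443455180800], [0, 0, 0, 0, 0, 0, 226806020811361591333493760,
   1835430366326794606979850240, 9930439266741935623290470400, 51117848291365099311286517760,
   263387742909518163155873955840, 1148770658106408490033899110400, 2199206116036073262799650816000,
   -528789212254665121832324053401600, -43977376146226373627032020654489600], [0, 0, 0, 0, 0, 0,
   226546315120169703736197120, 1827037921794577315070607360, 9749900610546240363370905600,
   47789510929531443616316129280, 208628709028563749401389957120, 449894669020455228846951628800, 0,
   -509465127740984815005638826393600], [0, 0, 0, 0, 0, 0, 225512112896289930502471680,
   1793889211694709848974295040, 9054929442135145042988236800, 35952422297692121420833751040,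
   57662338289679810554757120000], [0, 0, 0, 0, 0, 0, 221422143892670657876459520,
   1666078764532820869455544320, 6585169681659366855829094400, 4029789999821857280439091200], [0, 0,
   0, 0, 0, 0, 205647689757910215331676160, 1211685449982733845276917760], [0, 0, 0, 0, 0, 0,
   149561764849640530646138880], [], [], [], [], [], [], [], [], []]

def lamZ (t : T3) : ℤ :=
  if wt t = WN then (lamT.getD (t.1 / 2) []).getD (t.2.1 / 2) 0 else 0

lemma lamZ_zero (t : T3) (h : wt t ≠ WN) : lamZ t = 0 := by simp [lamZ, h]

def clsL : List Cls :=
  [⟨(13,false,false), [], [], [0, 2, 3, 4, 11, 14, 15, 6, 7, 12, 17, 18, 19, 8, 10, 20, 21, 22, 16,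
   23, 26, 27, 24, 25, 28, 29, 31, 32]⟩,
   ⟨(13,false,true), [], [], [2, 3, 4, 11, 14, 15, 1, 7, 12, 17, 18, 19, 9, 10, 20, 21, 22, 13, 16,
   26, 27, 28, 25, 29, 30, 31, 32, 33]⟩,
   ⟨(13,true,false), [], [], [6, 7, 11, 12, 14, 15, 9, 8, 10, 17, 18, 19, 13, 16, 20, 21, 23, 22, 24,
   25, 26, 27, 28, 31, 29, 32, 33, 5]⟩,
   ⟨(13,true,true), [], [], [7, 11, 12, 14, 15, 17, 10, 18, 19, 20, 21, 16, 22, 26, 27, 25, 28, 29,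
   31, 32, 33]⟩,
   ⟨(14,false,false), [], [], [0, 2, 3, 4, 11, 14, 15, 1, 6, 7, 12, 17, 18, 19, 9, 8, 10, 20, 21, 22,
   13, 16, 23, 26, 27, 28, 24, 25, 29, 30, 31, 32, 33, 34, 35, 5]⟩,
   ⟨(14,false,true), [(0,1,13)], [(0,(0,0,0))], [2, 3, 4, 11, 14, 15, 7, 12, 17, 18, 19, 20, 10, 21,
   22, 26, 27, 16, 28, 29, 30, 25, 32, 33, 31, 34, 35]⟩,
   ⟨(14,true,false), [(1,0,13)], [(1,(0,0,0))], [7, 11, 12, 14, 15, 17, 6, 10, 18, 19, 20, 21, 8, 16,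
   22, 26, 27, 23, 25, 28, 29, 24, 31, 32, 33, 34, 35]⟩,
   ⟨(14,true,true), [(1,5,8)], [(2,(0,0,0))], [7, 11, 12, 14, 15, 9, 10, 17, 18, 19, 20, 13, 16, 21,
   22, 26, 27, 25, 28, 29, 30, 31, 32, 33, 34, 35, 37]⟩,
   ⟨(15,false,false), [(0,2,13), (2,0,13)], [(0,(0,1,0)), (1,(1,0,0))], [0, 2, 3, 4, 11, 14, 15, 7,
   12, 17, 18, 19, 20, 6, 10, 21, 22, 26, 27, 8, 16, 28, 29, 30, 23, 25, 32, 33, 24, 31, 34, 35, 36,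
   37]⟩,
   ⟨(15,false,true), [(0,1,14), (2,5,8), (0,3,12), (0,5,10), (0,7,8)], [(0,(0,0,1)), (2,(1,0,0)),
   (3,(0,0,0)), (4,(0,0,0)), (5,(0,0,0))], [2, 3, 4, 1, 7, 11, 12, 14, 15, 9, 10, 17, 18, 19, 20, 13,
   16, 21, 22, 26, 27, 25, 28, 29, 30, 31, 32, 33, 34, 35, 37]⟩,
   ⟨(15,true,false), [(1,0,14), (1,6,8), (1,2,12)], [(1,(0,0,1)), (2,(0,1,0)), (6,(0,0,0))], [7, 11,
   12, 14, 9, 6, 10, 15, 17, 18, 19, 13, 8, 16, 20, 21, 22, 26, 23, 25, 27, 28, 29, 24, 30, 31, 32,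
   33, 34, 35, 36, 37, 5]⟩,
   ⟨(15,true,true), [(1,1,13), (1,5,9)], [(0,(1,0,0)), (1,(0,1,0))], [7, 11, 12, 14, 15, 10, 17, 18,
   19, 20, 21, 16, 22, 26, 27, 28, 25, 29, 30, 32, 31, 33, 34, 35, 37, 38]⟩,
   ⟨(16,false,false), [(0,2,14), (2,0,14), (2,6,8), (0,4,12), (0,6,10), (0,8,8), (2,2,12)],
   [(0,(0,1,1)), (1,(1,0,1)), (2,(1,1,0)), (3,(0,1,0)), (4,(0,1,0)), (5,(0,1,0)), (6,(1,0,0))], [0,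
   2, 3, 4, 1, 7, 11, 12, 14, 9, 6, 10, 15, 17, 18, 19, 13, 8, 16, 20, 21, 22, 26, 23, 25, 27, 28,
   29, 24, 30, 31, 32, 33, 34, 35, 36, 37, 5]⟩,
   ⟨(16,false,true), [(0,1,15), (0,3,13), (2,1,13), (2,5,9), (0,5,11), (0,7,9), (0,9,7)],
   [(0,(0,0,2)), (0,(0,2,0)), (0,(2,0,0)), (1,(1,1,0)), (3,(0,0,1)), (4,(0,0,1)), (5,(0,0,1))], [2,
   3, 4, 7, 11, 12, 14, 15, 10, 17, 18, 19, 20, 21, 16, 22, 26, 27, 28, 25, 29, 30, 32, 31, 33, 34,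
   35, 37, 38]⟩,
   ⟨(16,true,false), [(1,2,13), (1,0,15), (1,6,9), (3,0,13), (1,4,11)], [(0,(1,1,0)), (1,(0,0,2)),
   (1,(0,2,0)), (1,(2,0,0)), (6,(0,0,1))], [7, 11, 12, 14, 10, 15, 17, 18, 19, 20, 6, 16, 21, 22, 26,
   27, 8, 25, 28, 29, 30, 23, 31, 32, 33, 24, 34, 35, 36, 37, 38]⟩,
   ⟨(16,true,true), [(1,1,14), (1,5,10), (1,7,8), (3,5,8), (1,3,12), (1,9,6), (1,11,4), (1,13,2)],
   [(0,(1,0,1)), (1,(0,1,1)), (2,(0,2,0)), (2,(2,0,0)), (3,(1,0,0)), (4,(1,0,0)), (5,(1,0,0)),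
   (6,(0,1,0))], [7, 9, 11, 12, 14, 15, 10, 13, 17, 18, 19, 20, 16, 21, 22, 25, 26, 27, 28, 29, 30,
   31, 32, 33, 34, 35, 37, 38]⟩]

lemma chk_cls : ∀ d ∈ clsL, chkCls orbL gensL d = true := by decide +kernel

lemma chk_van : ∀ L ∈ gensL, ∀ P ∈ orbL, evL P L = 0 := by decide +kernel

lemma chk_gen : ∀ x ∈ gensL.zip (gwt.zip wgtL), (∀ y ∈ x.1, wt y.1 = x.2.1) ∧
    (∀ y ∈ x.2.2, y.1 ∈ orbL) ∧
    ∀ t ∈ monos (wcomp x.2.1), lamL lamZ (shL t x.1) = wL t x.2.2 := by decide +kernel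

lemma chk_ex : ∀ a ∈ [13, 14, 15, 16], ∀ i j : Bool, ∃ d ∈ clsL, d.n = (a, i, j) := by decide +kernel

lemma chk_ex13 : ∀ i j : Bool, ∃ d ∈ clsL, d.n = (13, i, j) ∧ d.fr = [] ∧ d.sel = [] := by decide +kernel

lemma chk_orb : ∀ P ∈ orbL, ∀ s ∈ [(1 : ℤ), -1], ∀ t ∈ [(1 : ℤ), -1],
    (s * P.1, t * P.2.1, (P.2.2 : ℤ)) ≠ (0, 0, 0) ∧
    2 ≤ (Finset.univ.filter fun k : Fin 31 => dotz (Lz k) (s * P.1, t * P.2.1, (P.2.2 : ℤ)) = 0).card := by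
  decide +kernel


/-! ### Part 2d: the functional vanishes on the square of the ideal -/

noncomputable def JI : Ideal PolyR := Ideal.span {p | ∃ L ∈ gensL, p = toPoly L}

lemma mem_JI (g : PolyR) (n : WT) (hn : n.1 ≤ 16) (hg : IsW n g)
    (hv : ∀ P ∈ orbL, eval (rp P) g = 0) : g ∈ JI := by
  have main : ∀ (g : PolyR) (n : WT), n.1 ∈ [13, 14, 15, 16] → IsW n g →
      (∀ P ∈ orbL, eval (rp P) g = 0) → ∃ d ∈ clsL, d.n = n ∧ g ∈ JI := by
    intro g n hn hg hv
    obtain ⟨d, hd, he⟩ := chk_ex n.1 hn n.2.1 n.2.2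
    have he' : d.n = n := he
    exact ⟨d, hd, he', cls_mem orbL gensL d (by decide) chk_van (chk_cls d hd) g (he' ▸ hg) hv⟩
  by_cases h13 : 13 ≤ n.1
  · obtain ⟨_, _, _, h⟩ := main g n (by simp only [List.mem_cons, List.not_mem_nil]; omega) hg hv
    exact h
  · obtain ⟨d, hd, he, hf, hs⟩ := chk_ex13 n.2.1 n.2.2
    have hc := chk_cls d hd
    have hc' : chkCls orbL [] d = true := by
      simp only [chkCls, rows1, hf, hs] at hc ⊢
      simpa using hc
    have hX : IsW (13 - n.1, false, false) (monomial (mo (0, 0, 13 - n.1)) (1 : ℝ)) := by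
      classical
      intro m hm
      rw [coeff_monomial] at hm
      split_ifs at hm with h
      · rw [← h, un_mo]; simp [wt]; rfl
      · simp at hm
    have hw : IsW d.n (monomial (mo (0, 0, 13 - n.1)) (1 : ℝ) * g) := by
      have := isW_mul hX hg
      rw [he]
      convert this using 1
      simp only [wadd, Bool.false_xor]
      congr 1
      omega
    have := cls_mem orbL [] d (by decide) (by simp) hc' _ hw (by
      intro P hP; rw [map_mul, hv P hP, mul_zero])
    simp only [List.not_mem_nil, false_and, exists_false, Set.setOf_false, Ideal.span_empty,
      Ideal.mem_bot, mul_eq_zero, monomial_eq_zero, one_ne_zero, false_or] at this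
    rw [this]
    exact JI.zero_mem

lemma Lam_JI (p : PolyR) (hp : p ∈ JI) : ∀ h, VI orbL h → Lam lamZ (p * h) = 0 := by
  unfold JI at hp
  refine Submodule.span_induction (p := fun p _ => ∀ h, VI orbL h → Lam lamZ (p * h) = 0)
    ?_ ?_ ?_ ?_ hp
  · rintro _ ⟨L, hL, rfl⟩ h hh
    have hm : L ∈ (gensL.zip (gwt.zip wgtL)).map Prod.fst := by
      rw [List.map_fst_zip (by decide)]; exact hL
    obtain ⟨x, hx, rfl⟩ := List.mem_map.1 hm
    obtain ⟨h1, h2, h3⟩ := chk_gen _ hx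
    exact Lam_gen lamZ_zero _ _ _ h1 h2 h3 h hh
  · intro h _; simp
  · intro x y _ _ hx hy h hh
    rw [add_mul, map_add, hx h hh, hy h hh, add_zero]
  · intro a x _ hx h hh
    rw [smul_eq_mul, mul_comm a x, mul_assoc]
    exact hx _ (VI_mul a hh)

lemma Lam_sq (g h : PolyR) (hg : VI orbL g) (hh : VI orbL h) : Lam lamZ (g * h) = 0 := by
  rw [sum_comp g, Finset.sum_mul, map_sum]
  apply Finset.sum_eq_zero
  intro n _
  have hgn := VI_comp hg n
  by_cases hn : n.1 ≤ 16
  · exact Lam_JI _ (mem_JI _ n hn (isW_comp n g) hgn) h hh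
  · rw [sum_comp h, Finset.mul_sum, map_sum]
    apply Finset.sum_eq_zero
    intro n' _
    have hhn := VI_comp hh n'
    by_cases hn' : n'.1 ≤ 16
    · rw [mul_comm]
      exact Lam_JI _ (mem_JI _ n' hn' (isW_comp n' h) hhn) _ (VI_of_isW (isW_comp n g) hgn)
    · refine Lam_isW lamZ_zero (n := wadd n n') ?_ (isW_mul (isW_comp n g) (isW_comp n' h))
      intro he
      have := congrArg Prod.fst he
      simp only [wadd, WN] at this
      omega

noncomputable def phi : PolyR →ₐ[ℝ] PolyR := aeval ![C u * X 0, X 1, X 2]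

lemma eval_phi (v : Fin 3 → ℝ) (g : PolyR) : eval v (phi g) = eval ![u * v 0, v 1, v 2] g := by
  have : (eval v).comp (phi : PolyR →+* PolyR) = eval ![u * v 0, v 1, v 2] := by
    apply MvPolynomial.ringHom_ext
    · intro r; simp [phi]
    · intro i; fin_cases i <;> simp [phi]
  exact congrArg (fun h => h g) this

lemma phi_VI (g : PolyR) (hg : g ∈ ⨅ P ∈ S313, pointIdeal (Projectivization.rep P)) :
    VI orbL (phi g) := by
  classical
  intro P hP c s t
  simp only [Submodule.mem_iInf] at hg
  have hs : ((s : ℤ)) ∈ [(1 : ℤ), -1] := by rcases Int.units_eq_one_or s with rfl | rfl <;> simp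
  have ht : ((t : ℤ)) ∈ [(1 : ℤ), -1] := by rcases Int.units_eq_one_or t with rfl | rfl <;> simp
  obtain ⟨hne, hcard⟩ := chk_orb P hP s hs t ht
  generalize hW : ((s : ℤ) * (P.1 : ℤ), (t : ℤ) * (P.2.1 : ℤ), (P.2.2 : ℤ)) = W at hne hcard
  set v : Fin 3 → ℝ := ![u * W.1, W.2.1, W.2.2] with hv
  have hv0 : v ≠ 0 := by
    intro h
    apply hne
    have a0 := congrFun h 0
    have a1 := congrFun h 1
    have a2 := congrFun h 2
    simp [hv, u_ne] at a0 a1 a2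
    ext <;> simp [a0, a1, a2]
  obtain ⟨a, ha⟩ := Projectivization.exists_smul_eq_mk_rep ℝ v hv0
  have ha0 : (a : ℝ) ≠ 0 := a.ne_zero
  have hav : (Projectivization.mk ℝ v hv0).rep = ![u * ((a : ℝ) * W.1), (a : ℝ) * W.2.1, (a : ℝ) * W.2.2] := by
    rw [← ha]
    ext k; fin_cases k <;> simp [hv, Units.smul_def]
    ring
  have hS : Projectivization.mk ℝ v hv0 ∈ S313 := by
    change 2 ≤ mult313 _
    unfold mult313
    rw [hav]
    refine hcard.trans (Finset.card_le_card ?_)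
    intro k hk
    simp only [Finset.mem_filter, Finset.mem_univ, true_and] at hk ⊢
    exact (line_eval_zero k W a ha0).2 hk
  have := hg _ hS (c / a)
  rw [eval_phi]
  have e : ![u * sp c s t P 0, sp c s t P 1, sp c s t P 2] =
      (c / (a : ℝ)) • (Projectivization.mk ℝ v hv0).rep := by
    rw [hav, ← hW]
    funext k; fin_cases k <;> simp [sp] <;> field_simp
  rw [e]
  exact this

/-! ### Part 2e: the functional does not vanish on `f` -/

def ins (t : T3) (c : ℤ) : LP → LP
  | [] => [(t, c)]
  | x :: L => if x.1 = t then (x.1, x.2 + c) :: L else x :: ins t c L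

lemma toPoly_ins (t : T3) (c : ℤ) (L : LP) : toPoly (ins t c L) = monomial (mo t) (c : ℝ) + toPoly L := by
  induction L with
  | nil => simp [ins]
  | cons x L ih =>
    rw [ins]
    split_ifs with h
    · rw [toPoly_cons, toPoly_cons, ← h]
      push_cast
      rw [map_add]; ring
    · rw [toPoly_cons, toPoly_cons, ih]; ring

def mul1 (t : T3) (c : ℤ) : LP → LP → LP
  | [], acc => acc
  | x :: L, acc => mul1 t c L (ins (t + x.1) (c * x.2) acc)

lemma toPoly_mul1 (t : T3) (c : ℤ) (L : LP) : ∀ acc, toPoly (mul1 t c L acc) =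
    monomial (mo t) (c : ℝ) * toPoly L + toPoly acc := by
  induction L with
  | nil => intro acc; simp [mul1]
  | cons x L ih =>
    intro acc
    rw [mul1, ih, toPoly_ins, toPoly_cons, mul_add, monomial_mul, mo_add]
    push_cast; ring

def mulL : LP → LP → LP
  | [], _ => []
  | x :: A, B => mul1 x.1 x.2 B (mulL A B)

lemma toPoly_mulL (A B : LP) : toPoly (mulL A B) = toPoly A * toPoly B := by
  induction A with
  | nil => simp [mulL]
  | cons x A ih => rw [mulL, toPoly_mul1, ih, toPoly_cons]; ring



def linL (k : Fin 31) : LP := [((1,0,0), (Lz k).1), ((0,1,0), (Lz k).2.1), ((0,0,1), (Lz k).2.2)]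

def gamL : LP :=
   [((0,0,12),2195390988288), ((0,2,10),-4927526535168), ((0,4,8),3140713709568),
   ((0,6,6),-743725006848), ((0,8,4),61787971584), ((0,10,2),-694738944), ((0,12,0),-59719680),
   ((2,0,10),-3695644901376), ((2,2,8),4711070564352), ((2,4,6),-1204181655552),
   ((2,6,4),163103901696), ((2,8,2),-11380580352), ((2,10,0),694738944), ((4,0,8),1766651461632),
   ((4,2,6),-1489635753984), ((4,4,4),202969400832), ((4,6,2),-12683215872), ((4,8,0),-1788106752),
   ((6,0,6),-284434011648), ((6,2,4),111223456128), ((6,4,2),-1834016256), ((6,6,0),3068596224),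
   ((8,0,4),18506662272), ((8,2,2),546271776), ((8,4,0),-1668278592), ((10,0,2),-473371776),
   ((10,2,0),-1003104), ((12,0,0),3172608)]

lemma eval_mono (v : Fin 3 → ℝ) (t : T3) (c : ℝ) :
    eval v (monomial (mo t) c) = c * (v 0 ^ t.1 * v 1 ^ t.2.1 * v 2 ^ t.2.2) := by
  rw [eval_monomial, Finsupp.prod_fintype _ _ (by simp), Fin.prod_univ_three]
  rfl

lemma phi_line (k : Fin 31) : ∃ s : ℝ, s ≠ 0 ∧ phi (lines313 k) = C s * toPoly (linL k) := by
  obtain ⟨s, hs, h⟩ := line_eval k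
  refine ⟨s, hs, ?_⟩
  apply MvPolynomial.funext
  intro v
  rw [eval_phi, h]
  simp only [linL, toPoly_cons, toPoly_nil, map_mul, map_add, eval_mono, eval_C, map_zero]
  ring

lemma phi_gam : phi Γpoly = C (1 / 17825792) * toPoly gamL := by
  apply MvPolynomial.funext
  intro v
  have := eval_gam 1 (v 0) (v 1) (v 2)
  simp only [one_mul, one_pow] at this
  rw [eval_phi, this]
  simp only [gamL, toPoly_cons, toPoly_nil, map_mul, map_add, eval_mono, eval_C, map_zero, gamN, bZ, cZ]
  push_cast
  ring

def nz (L : LP) : LP := L.filter fun x => x.2 != 0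

lemma toPoly_nz (L : LP) : toPoly (nz L) = toPoly L := by
  induction L with
  | nil => rfl
  | cons x L ih =>
    by_cases h : x.2 = 0
    · rw [nz, List.filter_cons_of_neg (by simp [h]), toPoly_cons, ← ih, h]; simp [nz]
    · rw [nz, List.filter_cons_of_pos (by simp [h]), toPoly_cons, toPoly_cons, ← ih]; rfl

def nmul (A B : LP) : LP := nz (mulL A B)

lemma toPoly_nmul (A B : LP) : toPoly (nmul A B) = toPoly A * toPoly B := by
  rw [nmul, toPoly_nz, toPoly_mulL]

def prodL (L : List LP) : LP := L.foldr nmul [((0,0,0),1)]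

lemma toPoly_prodL (L : List LP) : toPoly (prodL L) = (L.map toPoly).prod := by
  induction L with
  | nil =>
    have : mo (0, 0, 0) = 0 := by ext k; fin_cases k <;> rfl
    simp [prodL, this]
  | cons x L ih =>
    rw [List.map_cons, List.prod_cons, ← ih, ← toPoly_nmul]
    rfl

def idx0 : List (Fin 21) := [0, 1, 2, 3, 4, 5, 6]
def idx1 : List (Fin 21) := [7, 8, 9, 10, 11, 12, 13]
def idx2 : List (Fin 21) := [14, 15, 16, 17, 18, 19, 20]
def lnB (i : Fin 21) : LP := linL (idxB i)

def qA : LP :=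
   [((0,1,6),-16), ((0,3,4),16), ((2,1,4),17), ((2,3,2),-17), ((4,1,2),-1), ((4,3,0),1)]

def qB : LP :=
   [((0,1,6),-8192), ((0,3,4),10752), ((1,2,4),-13568), ((2,1,4),2944), ((1,0,6),12288),
   ((3,0,4),-10176), ((0,5,2),-2688), ((1,4,2),7360), ((2,3,2),-4672), ((4,1,2),4024),
   ((3,2,2),-4000), ((5,0,2),1884), ((0,7,0),128), ((1,6,0),-320), ((2,5,0),-96), ((4,3,0),152),
   ((3,4,0),496), ((5,2,0),-252), ((6,1,0),-162), ((7,0,0),-27)]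

def qC : LP :=
   [((0,1,6),8192), ((0,3,4),-10752), ((1,2,4),-13568), ((2,1,4),-2944), ((1,0,6),12288),
   ((3,0,4),-10176), ((0,5,2),2688), ((1,4,2),7360), ((2,3,2),4672), ((4,1,2),-4024),
   ((3,2,2),-4000), ((5,0,2),1884), ((0,7,0),-128), ((1,6,0),-320), ((2,5,0),96),
   ((4,3,0),-152), ((3,4,0),496), ((5,2,0),-252), ((6,1,0),162), ((7,0,0),-27)]

def qD : LP :=
   [((8,2,4),-24449344), ((8,0,6),-39006720), ((10,0,4),4098960), ((8,4,2),750464),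
   ((10,2,2),570240), ((12,0,2),-101736), ((8,6,0),-286912), ((10,4,0),85968),
   ((12,2,0),-12636), ((14,0,0),729), ((6,2,6),-2256896), ((6,4,4),80665088),
   ((6,6,2),-7561216), ((6,8,0),477952), ((4,6,4),-68724736), ((4,4,6),-85590016),
   ((4,8,2),8751104), ((4,10,0),-365568), ((2,6,6),-92864512), ((2,8,4),39047168),
   ((2,10,2),-4030464), ((2,12,0),126976), ((0,8,6),59899904), ((0,10,4),-9977856),
   ((0,12,2),688128), ((0,14,0),-16384), ((6,0,8),149852160), ((4,2,8),235094016),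
   ((2,4,8),225116160), ((0,6,8),-159645696), ((4,0,10),-250085376), ((2,2,10),-285212672),
   ((2,0,12),150994944), ((0,4,10),176160768), ((0,2,12),-67108864)]

def qE : LP :=
   [((12,5,4),-33634608), ((12,3,6),-75971216), ((14,3,4),5055084), ((12,7,2),-424080),
   ((14,5,2),699084), ((16,3,2),-101493), ((12,9,0),-286912), ((14,7,0),85968),
   ((16,5,0),-12636), ((18,3,0),729), ((10,5,6),353223104), ((10,7,4),71966400),
   ((10,9,2),-3161664), ((10,11,0),477952), ((8,9,4),54599424), ((8,7,6),-1500114432),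
   ((8,11,2),991488), ((8,13,0),-365568), ((6,9,6),1056550912), ((6,11,4),-104258560),
   ((6,13,2),2057216), ((6,15,0),126976), ((4,11,6),-516575232), ((4,13,4),54161408),
   ((4,15,2),-1454080), ((4,17,0),-16384), ((10,3,8),456043968), ((8,5,8),1327160832),
   ((6,7,8),2016311296), ((4,9,8),783339520), ((8,3,10),-3303951360), ((6,5,10),-7288709120),
   ((6,3,12),11118002176), ((4,7,10),-5339709440), ((4,5,12),13563265024), ((12,1,8),110316816),
   ((14,1,6),-5840136), ((16,1,4),114129), ((18,1,2),-729), ((10,1,10),-878549760),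
   ((8,1,12),3421679616), ((6,1,14),-6800080896), ((4,3,14),-15111290880),
   ((2,11,8),-498679808), ((2,13,6),114802688), ((2,15,4),-9945088), ((2,17,2),278528),
   ((2,9,10),1621688320), ((2,7,12),-621019136), ((2,5,14),-4029677568), ((4,1,16),6568280064),
   ((2,3,16),5838471168), ((0,11,10),1118044160), ((0,13,8),-170655744), ((0,15,6),11272192),
   ((0,17,4),-262144), ((0,9,12),-3512729600), ((0,7,14),5372903424), ((0,5,16),-3892314112),
   ((2,1,18),-2415919104), ((0,3,18),1073741824)]

lemma chkA : prodL (idx0.map lnB) = qA := by decide +kernel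
lemma chkB : prodL (idx1.map lnB) = qB := by decide +kernel
lemma chkC : prodL (idx2.map lnB) = qC := by decide +kernel
lemma chkD : nmul qB qC = qD := by decide +kernel
lemma chkE : nmul qA qD = qE := by decide +kernel

lemma toPoly_qE : toPoly qE = ∏ i : Fin 21, toPoly (lnB i) := by
  rw [Fin.prod_univ_def, show List.finRange 21 = idx0 ++ (idx1 ++ idx2) by decide, ← chkE,
    ← chkD, ← chkA, ← chkB, ← chkC]
  simp only [toPoly_nmul, toPoly_prodL, List.map_append, List.prod_append, List.map_map]
  rfl

def lam2 (G : LP) : LP → ℤ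
  | [] => 0
  | x :: A => x.2 * lamL lamZ (shL x.1 G) + lam2 G A

lemma Lam_lam2 (G A : LP) : Lam lamZ (toPoly A * toPoly G) = (lam2 G A : ℝ) := by
  induction A with
  | nil => simp [lam2]
  | cons x A ih =>
    have : (monomial (mo x.1) (x.2 : ℝ)) = (x.2 : ℝ) • monomial (mo x.1) (1 : ℝ) := by
      rw [smul_monomial, smul_eq_mul, mul_one]
    rw [toPoly_cons, add_mul, map_add, ih, this, smul_mul_assoc, map_smul, ← toPoly_shL,
      Lam_toPoly, lam2, smul_eq_mul]
    push_cast; rfl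

lemma chk_fin : lam2 gamL qE ≠ 0 := by decide +kernel

lemma Lam_f_ne : Lam lamZ (phi ((∏ i : Fin 21, linesB21 i) * Γpoly)) ≠ 0 := by
  have h : ∀ i : Fin 21, ∃ s : ℝ, s ≠ 0 ∧ phi (linesB21 i) = C s * toPoly (lnB i) := by
    intro i; rw [linesB_eq]; exact phi_line _
  choose s hs h using h
  have e : phi ((∏ i : Fin 21, linesB21 i) * Γpoly) =
      ((∏ i, s i) * (1 / 17825792)) • (toPoly qE * toPoly gamL) := by
    rw [map_mul, map_prod, phi_gam, toPoly_qE, smul_eq_C_mul, C_mul, map_prod]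
    simp only [h, Finset.prod_mul_distrib]
    ring
  rw [e, map_smul, Lam_lam2, smul_eq_mul]
  refine mul_ne_zero (mul_ne_zero (Finset.prod_ne_zero_iff.2 fun i _ => hs i) (by norm_num)) ?_
  exact_mod_cast chk_fin

lemma part2 : (∏ i : Fin 21, linesB21 i) * Γpoly ∉
        (⨅ P ∈ S313, pointIdeal (Projectivization.rep P)) ^ 2 := by
  intro hmem
  apply Lam_f_ne
  rw [pow_two] at hmem
  refine Submodule.mul_induction_on (C := fun F => Lam lamZ (phi F) = 0) hmem ?_ ?_
  · intro g hg h hh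
    rw [map_mul]
    exact Lam_sq _ _ (phi_VI g hg) (phi_VI h hh)
  · intro x y hx hy
    rw [map_add, map_add, hx, hy, add_zero]

/-- The degree-33 polynomial `f`, the product of the 21 linear forms of `B₂₁` and of the
degree-12 form `Γ`, belongs to the third symbolic power `I^(3) = ⋂_P I(P)³` of the ideal
`I` of the 127 intersection points of `A(31,3)`, but not to `I²`. -/
theorem stmt1 :
    (∏ i : Fin 21, linesB21 i) * Γpoly ∈
        (⨅ P ∈ S313, (pointIdeal (Projectivization.rep P)) ^ 3) ∧
    (∏ i : Fin 21, linesB21 i) * Γpoly ∉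
        (⨅ P ∈ S313, pointIdeal (Projectivization.rep P)) ^ 2 := by
  exact ⟨part1, part2⟩
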